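/- arXiv:2111.00294 — 15 statements merged into one kernel-verified Lean document; each statement's English description precedes it below -/
import Mathlib

section
/- Let d ≥ 1 and r ≥ 1 be integers, H a d×d complex matrix, a a d×1 complex column vector, w a nonzero 1×r complex row vector, ρ² := w·w* (a positive real), and ν, λ, X, Y real numbers. Define the (d+r)×(d+r) block matrix T by T₁₁ = (ν+λX)·H + λ²Y·a·a*, T₁₂ = (λY/ρ²)·a·w, T₂₁ = (λY/ρ²)·w*·a*, T₂₂ = (X/ρ²)·I_r + ((Y−X)/ρ⁴)·w*·w, where * denotes conjugate transpose. Then det T = ρ^(−2r)·X^(r−1)·Y·(ν+λX)^d·det H. -/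
open Matrix

/-- The determinant of a rank-one perturbation of a scalar matrix, without assuming that the
scalar is invertible. -/
theorem det_smul_one_add_smul_mul {R n : Type*} [CommRing R] [Fintype n] [DecidableEq n]
    [Nonempty n] (x z : R) (v : Matrix n (Fin 1) R) (w : Matrix (Fin 1) n R) :
    (x • (1 : Matrix n n R) + z • (v * w)).det
      = x ^ (Fintype.card n - 1) * (x + z * (w * v) 0 0) := by
  have hle : Fintype.card (Fin 1) ≤ Fintype.card n := by
    simpa using Nat.one_le_iff_ne_zero.mpr Fintype.card_ne_zero
  have h := congrArg (Polynomial.eval x) (charpoly_mul_comm_of_le (-(z • v)) w hle)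
  rw [Polynomial.eval_mul, eval_charpoly, eval_charpoly] at h
  simpa [smul_one_eq_diagonal] using h

theorem mul_mul_mul_of_fin_one {R m n k : Type*} [CommRing R] [Fintype n]
    (a : Matrix m (Fin 1) R) (w : Matrix (Fin 1) n R) (v : Matrix n (Fin 1) R)
    (b : Matrix (Fin 1) k R) :
    a * w * (v * b) = (w * v) 0 0 • (a * b) := by
  have hwv : w * v = (w * v) 0 0 • (1 : Matrix (Fin 1) (Fin 1) R) := by
    ext i j
    fin_cases i
    fin_cases j
    simp
  rw [Matrix.mul_assoc, ← Matrix.mul_assoc w, hwv]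
  simp

/-- The determinant of a block matrix whose off-diagonal blocks have rank one and are cleared by a
single unipotent block row operation. -/
theorem det_fromBlocks_rank_one {R m n : Type*} [CommRing R] [Fintype m] [DecidableEq m]
    [Fintype n] [DecidableEq n] [Nonempty n] (G : Matrix m m R)
    (a : Matrix m (Fin 1) R) (b : Matrix (Fin 1) m R)
    (v : Matrix n (Fin 1) R) (w : Matrix (Fin 1) n R) (l c s x z : R)
    (hs : (w * v) 0 0 = s) (hc : l * (x + z * s) = c) :
    (fromBlocks (G + (l * c * s) • (a * b)) (c • (a * w)) (c • (v * b))
      (x • (1 : Matrix n n R) + z • (v * w))).det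
      = G.det * (x ^ (Fintype.card n - 1) * (x + z * s)) := by
  have hU : fromBlocks 1 (-(l • (a * w))) 0 1 *
      fromBlocks (G + (l * c * s) • (a * b)) (c • (a * w)) (c • (v * b))
        (x • (1 : Matrix n n R) + z • (v * w))
      = fromBlocks G 0 (c • (v * b)) (x • (1 : Matrix n n R) + z • (v * w)) := by
    rw [fromBlocks_multiply]
    congr 1
    · simp only [Matrix.one_mul, Matrix.neg_mul, Matrix.smul_mul, Matrix.mul_smul,
        mul_mul_mul_of_fin_one, hs]
      module
    · simp only [Matrix.one_mul, Matrix.neg_mul, Matrix.smul_mul, Matrix.mul_smul, Matrix.mul_add,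
        Matrix.mul_one, mul_mul_mul_of_fin_one, hs, ← hc]
      module
    · simp
    · simp
  have h := congrArg det hU
  rw [det_mul, det_fromBlocks_zero₂₁, det_fromBlocks_zero₁₂, det_one, det_one, one_mul, one_mul,
    det_smul_one_add_smul_mul, hs] at h
  exact h

/-- Determinant formula of Lemma 2.1:
`det T = ρ^(−2r) · X^(r−1) · Y · (ν+λX)^d · det H` for the block Hessian matrix `T`. -/
theorem stmt0 (d r : ℕ) (hd : 1 ≤ d) (hr : 1 ≤ r)
    (H : Matrix (Fin d) (Fin d) ℂ) (a : Matrix (Fin d) (Fin 1) ℂ)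
    (w : Matrix (Fin 1) (Fin r) ℂ) (hw : w ≠ 0)
    (ρ : ℝ) (hρ : 0 < ρ) (hρw : (w * wᴴ) 0 0 = ((ρ ^ 2 : ℝ) : ℂ))
    (nu lam X Y : ℝ)
    (T : Matrix (Fin d ⊕ Fin r) (Fin d ⊕ Fin r) ℂ)
    (hT : T = Matrix.fromBlocks
      (((nu + lam * X : ℝ) : ℂ) • H + ((lam ^ 2 * Y : ℝ) : ℂ) • (a * aᴴ))
      (((lam * Y / ρ ^ 2 : ℝ) : ℂ) • (a * w))
      (((lam * Y / ρ ^ 2 : ℝ) : ℂ) • (wᴴ * aᴴ))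
      (((X / ρ ^ 2 : ℝ) : ℂ) • (1 : Matrix (Fin r) (Fin r) ℂ)
        + (((Y - X) / ρ ^ 4 : ℝ) : ℂ) • (wᴴ * w))) :
    T.det = ((((ρ ^ 2)⁻¹ ^ r * X ^ (r - 1) * Y * (nu + lam * X) ^ d : ℝ)) : ℂ) * H.det := by
  have hρ0 : (ρ : ℂ) ≠ 0 := by exact_mod_cast hρ.ne'
  have : Nonempty (Fin r) := ⟨⟨0, hr⟩⟩
  have hlc : ((lam ^ 2 * Y : ℝ) : ℂ)
      = (lam : ℂ) * ((lam * Y / ρ ^ 2 : ℝ) : ℂ) * ((ρ ^ 2 : ℝ) : ℂ) := by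
    push_cast
    field_simp
  rw [hT, hlc, det_fromBlocks_rank_one _ a aᴴ wᴴ w _ _ _ _ _ hρw
    (by push_cast; field_simp; ring), det_smul, Fintype.card_fin, Fintype.card_fin]
  obtain ⟨k, rfl⟩ : ∃ k, r = k + 1 := ⟨r - 1, by omega⟩
  rw [Nat.add_sub_cancel]
  push_cast
  rw [div_pow, inv_pow, pow_succ _ k]
  field_simp
  ring
end

section
/- Let d ≥ 1 and r ≥ 1 be integers, H an invertible d×d complex matrix, a a d×1 complex column vector, w a nonzero 1×r complex row vector, ρ² := w·w* > 0, and ν, λ, X, Y real numbers with X ≠ 0, Y ≠ 0 and ν+λX ≠ 0. Define the (d+r)×(d+r) block matrix T by T₁₁ = (ν+λX)·H + λ²Y·a·a*, T₁₂ = (λY/ρ²)·a·w, T₂₁ = (λY/ρ²)·w*·a*, T₂₂ = (X/ρ²)·I_r + ((Y−X)/ρ⁴)·w*·w. Then T is invertible and its inverse is the block matrix S with S₁₁ = (ν+λX)⁻¹·H⁻¹, S₁₂ = −λ(ν+λX)⁻¹·H⁻¹·a·w, S₂₁ = −λ(ν+λX)⁻¹·w*·a*·H⁻¹, S₂₂ =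 (ρ²/X)·I_r + (1/Y − 1/X)·w*·w + (λ²/(ν+λX))·(a*·H⁻¹·a)·w*·w, where a*·H⁻¹·a denotes the scalar entry of the 1×1 matrix a*H⁻¹a. -/
open Matrix

/-- A product of a row and a column acts on the left as multiplication by its only entry. -/
lemma mul_mul_eq_smul {K m n : Type*} [CommSemiring K] [Fintype m]
    (b : Matrix (Fin 1) m K) (a : Matrix m (Fin 1) K) (M : Matrix (Fin 1) n K) :
    b * (a * M) = (b * a) 0 0 • M := by
  rw [← Matrix.mul_assoc]
  ext i j
  fin_cases i
  simp [Matrix.mul_apply (M := b * a)]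

/-- Right inverse of a block matrix all of whose blocks are rank-one perturbations. -/
lemma fromBlocks_rankOne_mul_eq_one {K m n : Type*} [Field K] [Fintype m] [DecidableEq m]
    [Fintype n] [DecidableEq n] (H G : Matrix m m K) (hHG : H * G = 1)
    (a : Matrix m (Fin 1) K) (b : Matrix (Fin 1) m K)
    (w : Matrix (Fin 1) n K) (v : Matrix n (Fin 1) K)
    (ρ c l X Y : K) (hρ : ρ ≠ 0) (hwv : (w * v) 0 0 = ρ ^ 2)
    (hc : c ≠ 0) (hX : X ≠ 0) (hY : Y ≠ 0) :
    Matrix.fromBlocks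
      (c • H + (l ^ 2 * Y) • (a * b))
      ((l * Y / ρ ^ 2) • (a * w))
      ((l * Y / ρ ^ 2) • (v * b))
      ((X / ρ ^ 2) • (1 : Matrix n n K) + ((Y - X) / ρ ^ 4) • (v * w)) *
    Matrix.fromBlocks
      (c⁻¹ • G)
      ((-(l * c⁻¹)) • (G * a * w))
      ((-(l * c⁻¹)) • (v * b * G))
      ((ρ ^ 2 / X) • (1 : Matrix n n K) + (1 / Y - 1 / X) • (v * w)
        + ((l ^ 2 / c) * (b * G * a) 0 0) • (v * w)) = 1 := by
  have hwvm (M : Matrix (Fin 1) m K) : w * (v * M) = ρ ^ 2 • M := by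
    rw [mul_mul_eq_smul, hwv]
  have hwvn (M : Matrix (Fin 1) n K) : w * (v * M) = ρ ^ 2 • M := by
    rw [mul_mul_eq_smul, hwv]
  have hbGa (M : Matrix (Fin 1) n K) :
      b * (G * (a * M)) = (b * G * a) 0 0 • M := by
    rw [← Matrix.mul_assoc b, mul_mul_eq_smul]
  have hHGn (M : Matrix m n K) : H * (G * M) = M := by
    rw [← Matrix.mul_assoc, hHG, Matrix.one_mul]
  generalize (b * G * a) 0 0 = q at *
  rw [Matrix.fromBlocks_multiply, ← Matrix.fromBlocks_one]
  congr 1 <;>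
  simp only [Matrix.mul_add, Matrix.add_mul, Matrix.smul_mul, Matrix.mul_smul, Matrix.mul_one,
    Matrix.one_mul, Matrix.mul_assoc, hwvm, hwvn, hbGa, hHGn, hHG] <;>
  match_scalars <;> field_simp <;> ring

/-- Block-inverse formula of Lemma 2.1: `T` is invertible with inverse the
explicit block matrix `S`. -/
theorem stmt1 (d r : ℕ) (hd : 1 ≤ d) (hr : 1 ≤ r)
    (H : Matrix (Fin d) (Fin d) ℂ) (hH : IsUnit H)
    (a : Matrix (Fin d) (Fin 1) ℂ)
    (w : Matrix (Fin 1) (Fin r) ℂ) (hw : w ≠ 0)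
    (ρ : ℝ) (hρ : 0 < ρ) (hρw : (w * wᴴ) 0 0 = ((ρ ^ 2 : ℝ) : ℂ))
    (nu lam X Y : ℝ) (hX : X ≠ 0) (hY : Y ≠ 0) (hnl : nu + lam * X ≠ 0)
    (T S : Matrix (Fin d ⊕ Fin r) (Fin d ⊕ Fin r) ℂ)
    (hT : T = Matrix.fromBlocks
      (((nu + lam * X : ℝ) : ℂ) • H + ((lam ^ 2 * Y : ℝ) : ℂ) • (a * aᴴ))
      (((lam * Y / ρ ^ 2 : ℝ) : ℂ) • (a * w))
      (((lam * Y / ρ ^ 2 : ℝ) : ℂ) • (wᴴ * aᴴ))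
      (((X / ρ ^ 2 : ℝ) : ℂ) • (1 : Matrix (Fin r) (Fin r) ℂ)
        + (((Y - X) / ρ ^ 4 : ℝ) : ℂ) • (wᴴ * w)))
    (hS : S = Matrix.fromBlocks
      ((((nu + lam * X : ℝ))⁻¹ : ℝ) • H⁻¹)
      (((-(lam * (nu + lam * X)⁻¹) : ℝ) : ℂ) • (H⁻¹ * a * w))
      (((-(lam * (nu + lam * X)⁻¹) : ℝ) : ℂ) • (wᴴ * aᴴ * H⁻¹))
      (((ρ ^ 2 / X : ℝ) : ℂ) • (1 : Matrix (Fin r) (Fin r) ℂ)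
        + ((1 / Y - 1 / X : ℝ) : ℂ) • (wᴴ * w)
        + (((lam ^ 2 / (nu + lam * X) : ℝ) : ℂ) * (aᴴ * H⁻¹ * a) 0 0) • (wᴴ * w))) :
    IsUnit T ∧ T⁻¹ = S := by
  have hmul : T * S = 1 := by
    rw [hT, hS]
    have hwv : (w * wᴴ) 0 0 = (ρ : ℂ) ^ 2 := by rw [hρw]; push_cast; rfl
    have hHG : H * H⁻¹ = 1 := Matrix.mul_nonsing_inv H ((Matrix.isUnit_iff_isUnit_det H).1 hH)
    have key := fromBlocks_rankOne_mul_eq_one H H⁻¹ hHG a aᴴ w wᴴ (ρ : ℂ)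
      ((nu + lam * X : ℝ) : ℂ) lam X Y (by exact_mod_cast hρ.ne') hwv
      (by exact_mod_cast hnl) (by exact_mod_cast hX) (by exact_mod_cast hY)
    have hreal : ((nu + lam * X)⁻¹ : ℝ) • H⁻¹ = (((nu + lam * X : ℝ) : ℂ))⁻¹ • H⁻¹ := by
      rw [← Complex.ofReal_inv]
      rfl
    rw [hreal]
    push_cast at key ⊢
    exact key
  exact ⟨IsUnit.of_mul_eq_one S hmul, Matrix.inv_eq_right_inv hmul⟩
end

section
/- Let d ≥ 1 be an integer and a, λ, μ real numbers, and let I be an open interval containing 0 on which 1+ax > 0, 1+λx > 0 and aλx+2a−λ ≠ 0. Set γ := λ+μ−2a and define for x ∈ I: φ(x) := ((1+ax)^(2d+1)·(aλx+2a−λ)/(1+λx)^d) · ∫₀^x (1+λu)^d·(μ(1+λu) − γ(1+au)²) / ((1+au)^(2d+2)·(aλu+2a−λ)²) du. Then φ(0) = 0, φ has derivative 1 at 0, and for every x ∈ I, φ is differentiable at x with φ'(x) = (μ(1+λx) − γ(1+ax)²)/((1+ax)(aλx+2a−λ)) − (dλ/(λx+1) − (2d+1)a/(ax+1) − λa/(aλx+2a−λ))·φ(x).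 -/
theorem hasDerivAt_one_add_mul_pow (n : ℕ) (c x : ℝ) (h : 0 < 1 + c * x) :
    HasDerivAt (fun y : ℝ => (1 + c * y) ^ n) ((n : ℝ) * c / (c * x + 1) * (1 + c * x) ^ n) x := by
  have h1 : HasDerivAt (fun y : ℝ => 1 + c * y) c x := by
    simpa using ((hasDerivAt_id x).const_mul c).const_add 1
  refine (h1.fun_pow n).congr_deriv ?_
  have h2 : c * x + 1 ≠ 0 := by linarith
  cases n with
  | zero => simp
  | succ k =>
    rw [Nat.add_sub_cancel, pow_succ, add_comm 1 (c * x)]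
    field_simp

theorem hasDerivAt_intervalIntegral_of_continuousOn_Ioo {f : ℝ → ℝ} {p q c x : ℝ}
    (hf : ContinuousOn f (Set.Ioo p q)) (hc : c ∈ Set.Ioo p q) (hx : x ∈ Set.Ioo p q) :
    HasDerivAt (fun y => ∫ u in c..y, f u) (f x) x :=
  intervalIntegral.integral_hasDerivAt_right
    (hf.mono (Set.ordConnected_Ioo.uIcc_subset hc hx)).intervalIntegrable
    (hf.stronglyMeasurableAtFilter isOpen_Ioo x hx)
    (hf.continuousAt (isOpen_Ioo.mem_nhds hx))

/-- Momentum-profile formula of Part (I) of Theorem 1.1 (formula (1.1)):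
the profile `φ` satisfies `φ(0)=0`, `φ'(0)=1` and the first-order linear ODE. -/
theorem stmt4 (d : ℕ) (hd : 1 ≤ d) (a lam mu : ℝ) (p q : ℝ)
    (hp : p < 0) (hq : 0 < q)
    (hpos1 : ∀ x ∈ Set.Ioo p q, 0 < 1 + a * x)
    (hpos2 : ∀ x ∈ Set.Ioo p q, 0 < 1 + lam * x)
    (hne : ∀ x ∈ Set.Ioo p q, a * lam * x + 2 * a - lam ≠ 0)
    (γ : ℝ) (hγ : γ = lam + mu - 2 * a)
    (φ : ℝ → ℝ)
    (hφ : ∀ x, φ x =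
      (1 + a * x) ^ (2 * d + 1) * (a * lam * x + 2 * a - lam) / (1 + lam * x) ^ d *
        ∫ u in (0:ℝ)..x,
          (1 + lam * u) ^ d * (mu * (1 + lam * u) - γ * (1 + a * u) ^ 2) /
            ((1 + a * u) ^ (2 * d + 2) * (a * lam * u + 2 * a - lam) ^ 2)) :
    φ 0 = 0 ∧ HasDerivAt φ 1 0 ∧
      ∀ x ∈ Set.Ioo p q, HasDerivAt φ
        ((mu * (1 + lam * x) - γ * (1 + a * x) ^ 2) /
            ((1 + a * x) * (a * lam * x + 2 * a - lam)) -
          ((d : ℝ) * lam / (lam * x + 1) - (2 * (d : ℝ) + 1) * a / (a * x + 1) -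
            lam * a / (a * lam * x + 2 * a - lam)) * φ x) x := by
  have h0 : (0 : ℝ) ∈ Set.Ioo p q := ⟨hp, hq⟩
  have hφ0 : φ 0 = 0 := by rw [hφ]; simp
  have hode : ∀ x ∈ Set.Ioo p q, HasDerivAt φ
        ((mu * (1 + lam * x) - γ * (1 + a * x) ^ 2) /
            ((1 + a * x) * (a * lam * x + 2 * a - lam)) -
          ((d : ℝ) * lam / (lam * x + 1) - (2 * (d : ℝ) + 1) * a / (a * x + 1) -
            lam * a / (a * lam * x + 2 * a - lam)) * φ x) x := by
    intro x hx
    have hA := hpos1 x hx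
    have hM := hpos2 x hx
    have hL := hne x hx
    have hcont : ContinuousOn (fun u : ℝ =>
        (1 + lam * u) ^ d * (mu * (1 + lam * u) - γ * (1 + a * u) ^ 2) /
          ((1 + a * u) ^ (2 * d + 2) * (a * lam * u + 2 * a - lam) ^ 2)) (Set.Ioo p q) := by
      refine ContinuousOn.div (by fun_prop) (by fun_prop) fun u hu => ?_
      exact mul_ne_zero (pow_ne_zero _ (hpos1 u hu).ne') (pow_ne_zero _ (hne u hu))
    have hI := hasDerivAt_intervalIntegral_of_continuousOn_Ioo hcont h0 hx
    have hdL : HasDerivAt (fun y : ℝ => a * lam * y + 2 * a - lam) (a * lam) x := by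
      simpa using (((hasDerivAt_id x).const_mul (a * lam)).add_const (2 * a)).sub_const lam
    have hdA := hasDerivAt_one_add_mul_pow (2 * d + 1) a x hA
    have hdM := hasDerivAt_one_add_mul_pow d lam x hM
    have hder := ((hdA.fun_mul hdL).fun_div hdM (pow_pos hM d).ne').fun_mul hI
    rw [← funext hφ] at hder
    refine hder.congr_deriv ?_
    rw [hφ x, show 2 * d + 2 = (2 * d + 1) + 1 by ring, pow_succ (1 + a * x) (2 * d + 1)]
    have hP := (pow_pos hA (2 * d + 1)).ne'
    have hQ := (pow_pos hM d).ne'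
    push_cast
    rw [add_comm (lam * x) 1, add_comm (a * x) 1]
    generalize (∫ u in (0:ℝ)..x, (_ : ℝ)) = J
    generalize (1 + a * x) ^ (2 * d + 1) = P at *
    generalize (1 + lam * x) ^ d = Q at *
    generalize a * lam * x + 2 * a - lam = L at *
    generalize 1 + a * x = A at *
    generalize 1 + lam * x = M at *
    have hA' := hA.ne'
    have hM' := hM.ne'
    field_simp
    ring
  refine ⟨hφ0, (hode 0 h0).congr_deriv ?_, hode⟩
  have hL : 2 * a - lam ≠ 0 := by simpa using hne 0 h0
  rw [hφ0, hγ]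
  simp only [mul_zero, add_zero, zero_add, sub_zero, one_pow, mul_one, one_mul]
  rw [div_eq_one_iff_eq hL]
  ring
end

section
/- Let d ≥ 1 be an integer and a, b, λ, ν, μ real numbers, let x0 be a real number and I an open interval containing x0 on which ax+b > 0, ν+λx > 0 and aλx+2aν−bλ ≠ 0. Set γ := μ(ν+λx0)/(b+ax0)² and define for x ∈ I: φ(x) := ((ax+b)^(2d+1)·(aλx+2aν−bλ)/(ν+λx)^d) · ∫_{x0}^x (ν+λu)^d·(μ(ν+λu) − γ(au+b)²) / ((au+b)^(2d+2)·(aλu+2aν−bλ)²) du. Then φ(x0) = 0, φ has derivative 0 at x0, and for every x ∈ I, φ is differentiable at x with φ'(x) = (μ(ν+λx) − γ(ax+b)²)/((ax+b)(aλx+2aν−bλ)) − (dλ/(λx+ν) − (2d+1)a/(ax+b) − λa/(aλx+2aν−bλ))·φ(x). -/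
/-- Momentum-profile formulas (1.2)/(1.3) of Part (II) of Theorem 1.1 (r = 1):
the profile `φ` vanishes to second order at `x0` and satisfies the linear ODE. -/
theorem stmt5 (d : ℕ) (hd : 1 ≤ d) (a b lam nu mu x0 : ℝ) (p q : ℝ)
    (hp : p < x0) (hq : x0 < q)
    (hpos1 : ∀ x ∈ Set.Ioo p q, 0 < a * x + b)
    (hpos2 : ∀ x ∈ Set.Ioo p q, 0 < nu + lam * x)
    (hne : ∀ x ∈ Set.Ioo p q, a * lam * x + 2 * a * nu - b * lam ≠ 0)
    (γ : ℝ) (hγ : γ = mu * (nu + lam * x0) / (b + a * x0) ^ 2)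
    (φ : ℝ → ℝ)
    (hφ : ∀ x, φ x =
      (a * x + b) ^ (2 * d + 1) * (a * lam * x + 2 * a * nu - b * lam) / (nu + lam * x) ^ d *
        ∫ u in x0..x,
          (nu + lam * u) ^ d * (mu * (nu + lam * u) - γ * (a * u + b) ^ 2) /
            ((a * u + b) ^ (2 * d + 2) * (a * lam * u + 2 * a * nu - b * lam) ^ 2)) :
    φ x0 = 0 ∧ HasDerivAt φ 0 x0 ∧
      ∀ x ∈ Set.Ioo p q, HasDerivAt φ
        ((mu * (nu + lam * x) - γ * (a * x + b) ^ 2) /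
            ((a * x + b) * (a * lam * x + 2 * a * nu - b * lam)) -
          ((d : ℝ) * lam / (lam * x + nu) - (2 * (d : ℝ) + 1) * a / (a * x + b) -
            lam * a / (a * lam * x + 2 * a * nu - b * lam)) * φ x) x := by
  have hx0 : x0 ∈ Set.Ioo p q := ⟨hp, hq⟩
  have hzero : φ x0 = 0 := by rw [hφ, intervalIntegral.integral_same, mul_zero]
  have hode : ∀ x ∈ Set.Ioo p q, HasDerivAt φ
        ((mu * (nu + lam * x) - γ * (a * x + b) ^ 2) /
            ((a * x + b) * (a * lam * x + 2 * a * nu - b * lam)) -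
          ((d : ℝ) * lam / (lam * x + nu) - (2 * (d : ℝ) + 1) * a / (a * x + b) -
            lam * a / (a * lam * x + 2 * a * nu - b * lam)) * φ x) x := by
    intro x hx
    have hcont : ContinuousOn (fun u => (nu + lam * u) ^ d *
        (mu * (nu + lam * u) - γ * (a * u + b) ^ 2) /
          ((a * u + b) ^ (2 * d + 2) * (a * lam * u + 2 * a * nu - b * lam) ^ 2))
        (Set.Ioo p q) := by
      refine ContinuousOn.div (by fun_prop) (by fun_prop) fun u hu => ?_
      exact mul_ne_zero (pow_ne_zero _ (hpos1 u hu).ne') (pow_ne_zero _ (hne u hu))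
    have hint := intervalIntegral.integral_hasDerivAt_right
      ((hcont.mono (Set.ordConnected_Ioo.uIcc_subset hx0 hx)).intervalIntegrable)
      (hcont.stronglyMeasurableAtFilter isOpen_Ioo x hx)
      (hcont.continuousAt (isOpen_Ioo.mem_nhds hx))
    have hA : HasDerivAt (fun x => a * x + b) a x := by
      simpa using ((hasDerivAt_id x).const_mul a).add_const b
    have hB : HasDerivAt (fun x => nu + lam * x) lam x := by
      simpa using ((hasDerivAt_id x).const_mul lam).const_add nu
    have hC : HasDerivAt (fun x => a * lam * x + 2 * a * nu - b * lam) (a * lam) x := by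
      simpa using (((hasDerivAt_id x).const_mul (a * lam)).add_const (2 * a * nu)).sub_const
        (b * lam)
    have h1 := (hpos1 x hx).ne'
    have h2 := (hpos2 x hx).ne'
    have h3 := hne x hx
    have hprod := (((hA.fun_pow (2 * d + 1)).fun_mul hC).fun_div (hB.fun_pow d)
      (pow_ne_zero d h2)).fun_mul hint
    rw [funext hφ]
    refine hprod.congr_deriv ?_
    dsimp only
    generalize (∫ u in x0..x, (nu + lam * u) ^ d *
        (mu * (nu + lam * u) - γ * (a * u + b) ^ 2) /
          ((a * u + b) ^ (2 * d + 2) * (a * lam * u + 2 * a * nu - b * lam) ^ 2)) = J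
    rw [add_comm (lam * x) nu]
    generalize a * lam * x + 2 * a * nu - b * lam = C at h3 ⊢
    generalize a * x + b = A at h1 ⊢
    generalize nu + lam * x = B at h2 ⊢
    obtain ⟨n, rfl⟩ : ∃ n, d = n + 1 := ⟨d - 1, by omega⟩
    simp only [Nat.add_sub_cancel]
    push_cast
    field_simp
    ring
  refine ⟨hzero, ?_, hode⟩
  refine (hode x0 hx0).congr_deriv ?_
  have h1 := (hpos1 x0 hx0).ne'
  have hnum : mu * (nu + lam * x0) - γ * (a * x0 + b) ^ 2 = 0 := by
    rw [hγ, add_comm b, div_mul_cancel₀ _ (pow_ne_zero 2 h1), sub_self]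
  rw [hzero, hnum, zero_div, mul_zero, sub_zero]
end

section
/- Let r > 1 and d ≥ 1 be integers, n := d+r, and a, b, μ, x1 real numbers with x1 > 0. Let I be an open interval containing x1 on which x > 0, ax+b > 0 and ax−b ≠ 0. Define for x ∈ I: φ(x) := ((ax+b)^(2n−1)·(ax−b)/x^(n−1)) · ∫_{x1}^x u^(n−1)·(μu − r(b+au)²) / ((b+au)^(2n)·(au−b)²) du. Then: (i) φ(x1) = 0; (ii) for every x ∈ I, φ is differentiable at x with φ'(x) = (μx − r(ax+b)²)/((ax+b)(ax−b)) − ((n−1)/x − (2n−1)a/(ax+b) − a/(ax−b))·φ(x); (iii) in particular φ'(x1) = (μx1 − r(ax1+b)²)/((ax1+b)(ax1−b)), so φ'(x1) = −1 if and only if μ = (ax1+b)·(r(ax1+b) − (ax1−b))/x1. -/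
/-- Logarithmic derivative of the integrating factor of the momentum-profile equation. -/
theorem hasDerivAt_integratingFactor (m : ℕ) {a b x : ℝ} (hx : x ≠ 0) (hA : a * x + b ≠ 0)
    (hB : a * x - b ≠ 0) :
    HasDerivAt (fun y : ℝ => (a * y + b) ^ (2 * m + 1) * (a * y - b) / y ^ m)
      (-((m : ℝ) / x - (2 * (m : ℝ) + 1) * a / (a * x + b) - a / (a * x - b)) *
        ((a * x + b) ^ (2 * m + 1) * (a * x - b) / x ^ m)) x := by
  have hlin : HasDerivAt (fun y : ℝ => a * y) a x := by
    simpa using (hasDerivAt_id x).const_mul a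
  have hpow : HasDerivAt (fun y : ℝ => y ^ m) ((m : ℝ) / x * x ^ m) x := by
    refine (hasDerivAt_pow m x).congr_deriv ?_
    rcases m with _ | k
    · simp
    · simp only [Nat.add_sub_cancel, pow_succ]
      field_simp
  refine ((((hlin.add_const b).pow (2 * m + 1)).mul (hlin.sub_const b)).div hpow
    (pow_ne_zero m hx)).congr_deriv ?_
  simp only [Nat.add_sub_cancel, Pi.mul_apply, Pi.pow_apply, pow_succ (a * x + b) (2 * m)]
  push_cast
  field_simp
  ring

/-- Differentiability of the primitive of a function continuous on an open interval. -/
theorem ContinuousOn.hasDerivAt_integral_Ioo {g : ℝ → ℝ} {p q c x : ℝ}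
    (hg : ContinuousOn g (Set.Ioo p q)) (hc : c ∈ Set.Ioo p q) (hx : x ∈ Set.Ioo p q) :
    HasDerivAt (fun y => ∫ u in c..y, g u) (g x) x :=
  intervalIntegral.integral_hasDerivAt_right
    (hg.mono (Set.ordConnected_Ioo.uIcc_subset hc hx)).intervalIntegrable
    (hg.stronglyMeasurableAtFilter isOpen_Ioo x hx) (hg.continuousAt (isOpen_Ioo.mem_nhds hx))

/-- Momentum-profile formulas of Part (IV) of Theorem 1.1 (r > 1, ν = 0):
`φ(x1) = 0`, the first-order ODE holds, and `φ'(x1) = −1` iff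
`μ = (ax1+b)(r(ax1+b)−(ax1−b))/x1`. -/
theorem stmt6 (d r : ℕ) (hd : 1 ≤ d) (hr : 1 < r) (n : ℕ) (hn : n = d + r)
    (a b mu x1 : ℝ) (hx1 : 0 < x1) (p q : ℝ)
    (hp : p < x1) (hq : x1 < q)
    (hpos0 : ∀ x ∈ Set.Ioo p q, 0 < x)
    (hpos1 : ∀ x ∈ Set.Ioo p q, 0 < a * x + b)
    (hne : ∀ x ∈ Set.Ioo p q, a * x - b ≠ 0)
    (φ : ℝ → ℝ)
    (hφ : ∀ x, φ x =
      (a * x + b) ^ (2 * n - 1) * (a * x - b) / x ^ (n - 1) *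
        ∫ u in x1..x,
          u ^ (n - 1) * (mu * u - (r : ℝ) * (b + a * u) ^ 2) /
            ((b + a * u) ^ (2 * n) * (a * u - b) ^ 2)) :
    φ x1 = 0 ∧
      (∀ x ∈ Set.Ioo p q, HasDerivAt φ
        ((mu * x - (r : ℝ) * (a * x + b) ^ 2) / ((a * x + b) * (a * x - b)) -
          (((n : ℝ) - 1) / x - (2 * (n : ℝ) - 1) * a / (a * x + b) -
            a / (a * x - b)) * φ x) x) ∧
      HasDerivAt φ
        ((mu * x1 - (r : ℝ) * (a * x1 + b) ^ 2) / ((a * x1 + b) * (a * x1 - b))) x1 ∧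
      ((mu * x1 - (r : ℝ) * (a * x1 + b) ^ 2) / ((a * x1 + b) * (a * x1 - b)) = -1 ↔
        mu = (a * x1 + b) * ((r : ℝ) * (a * x1 + b) - (a * x1 - b)) / x1) := by
  obtain ⟨m, rfl⟩ : ∃ m, n = m + 1 := ⟨n - 1, by omega⟩
  have hmem : x1 ∈ Set.Ioo p q := ⟨hp, hq⟩
  have h0 : φ x1 = 0 := by simp [hφ]
  have hode : ∀ x ∈ Set.Ioo p q, HasDerivAt φ
      ((mu * x - (r : ℝ) * (a * x + b) ^ 2) / ((a * x + b) * (a * x - b)) -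
        (((m + 1 : ℕ) : ℝ) - 1) / x * φ x + (2 * ((m + 1 : ℕ) : ℝ) - 1) * a / (a * x + b) * φ x +
          a / (a * x - b) * φ x) x := by
    intro x hx
    have hx0 := (hpos0 x hx).ne'
    have hA := (hpos1 x hx).ne'
    have hB := hne x hx
    have hcont : ContinuousOn (fun u : ℝ => u ^ m * (mu * u - (r : ℝ) * (b + a * u) ^ 2) /
        ((b + a * u) ^ (2 * (m + 1)) * (a * u - b) ^ 2)) (Set.Ioo p q) := by
      refine ContinuousOn.div (by fun_prop) (by fun_prop) fun u hu => ?_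
      have hu1 : b + a * u ≠ 0 := by
        rw [add_comm]
        exact (hpos1 u hu).ne'
      exact mul_ne_zero (pow_ne_zero _ hu1) (pow_ne_zero _ (hne u hu))
    have hφ' : φ = fun y => (a * y + b) ^ (2 * m + 1) * (a * y - b) / y ^ m *
        ∫ u in x1..y, u ^ m * (mu * u - (r : ℝ) * (b + a * u) ^ 2) /
          ((b + a * u) ^ (2 * (m + 1)) * (a * u - b) ^ 2) := funext hφ
    have hsource : (a * x + b) ^ (2 * m + 1) * (a * x - b) / x ^ m *
        (x ^ m * (mu * x - (r : ℝ) * (b + a * x) ^ 2) /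
          ((b + a * x) ^ (2 * (m + 1)) * (a * x - b) ^ 2)) =
        (mu * x - (r : ℝ) * (a * x + b) ^ 2) / ((a * x + b) * (a * x - b)) := by
      rw [add_comm b, show 2 * (m + 1) = 2 * m + 1 + 1 by ring, pow_succ _ (2 * m + 1)]
      field_simp
    have hd := (hasDerivAt_integratingFactor m hx0 hA hB).mul
      (hcont.hasDerivAt_integral_Ioo hmem hx)
    rw [hsource] at hd
    rw [hφ']
    refine hd.congr_deriv ?_
    push_cast
    ring
  have hA := (hpos1 x1 hmem).ne'
  have hB := hne x1 hmem
  refine ⟨h0, fun x hx => (hode x hx).congr_deriv (by ring), ?_, ?_⟩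
  · simpa [h0] using hode x1 hmem
  · rw [div_eq_iff (mul_ne_zero hA hB), eq_div_iff hx1.ne']
    constructor <;> intro h <;> linear_combination h
end

section
/- Let d ≥ 1 and r ≥ 1 be integers, n := d+r, and a, b, μ real numbers with a ≠ 0. Let I be an open interval on which x ≠ 0, ax+b ≠ 0 and ax−b ≠ 0, and let φ : ℝ → ℝ be twice differentiable on I. Suppose there exists a constant c̃ such that for all x ∈ I: (1 − 2ax/(ax+b))·φ'(x) + ((n−1)/x − 2a(n−1)/(ax+b) − (2ax/(ax+b))·((n−1)/x) + 2(2n−1)a²x/(ax+b)²)·φ(x) + μx/(ax+b)² − r = c̃. Then for all x ∈ I: φ''(x) + ((n−1)/x − 2an/(ax+b))·φ'(x) + (2(2n−1)a²/(ax+b)² − 2a(n−1)/(x(ax+b)) − (n−1)/x²)·φ(x) + μ/(ax+b)² = 0. -/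
/-- Step (II-2) of the proof of Theorem 2.3 (case ν = 0): if the quantity `A`
is constant on `I`, then `φ` satisfies the second-order equation. -/
theorem stmt7 (d r : ℕ) (hd : 1 ≤ d) (hr : 1 ≤ r) (n : ℕ) (hn : n = d + r)
    (a b mu : ℝ) (ha : a ≠ 0) (p q : ℝ)
    (hne0 : ∀ x ∈ Set.Ioo p q, x ≠ 0)
    (hne1 : ∀ x ∈ Set.Ioo p q, a * x + b ≠ 0)
    (hne2 : ∀ x ∈ Set.Ioo p q, a * x - b ≠ 0)
    (φ φ' φ'' : ℝ → ℝ)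
    (hφ' : ∀ x ∈ Set.Ioo p q, HasDerivAt φ (φ' x) x)
    (hφ'' : ∀ x ∈ Set.Ioo p q, HasDerivAt φ' (φ'' x) x)
    (ctil : ℝ)
    (hconst : ∀ x ∈ Set.Ioo p q,
      (1 - 2 * a * x / (a * x + b)) * φ' x +
        (((n : ℝ) - 1) / x - 2 * a * ((n : ℝ) - 1) / (a * x + b) -
          (2 * a * x / (a * x + b)) * (((n : ℝ) - 1) / x) +
          2 * (2 * (n : ℝ) - 1) * a ^ 2 * x / (a * x + b) ^ 2) * φ x +
        mu * x / (a * x + b) ^ 2 - (r : ℝ) = ctil) :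
    ∀ x ∈ Set.Ioo p q,
      φ'' x + (((n : ℝ) - 1) / x - 2 * a * (n : ℝ) / (a * x + b)) * φ' x +
        (2 * (2 * (n : ℝ) - 1) * a ^ 2 / (a * x + b) ^ 2 -
          2 * a * ((n : ℝ) - 1) / (x * (a * x + b)) - ((n : ℝ) - 1) / x ^ 2) * φ x +
        mu / (a * x + b) ^ 2 = 0 := by
  intro x hx
  have hx0 := hne0 x hx
  have hx1 := hne1 x hx
  have hx2 := hne2 x hx
  have hid : HasDerivAt (fun y : ℝ => y) 1 x := hasDerivAt_id x
  have hf : HasDerivAt (fun y : ℝ => a * y + b) a x := by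
    simpa using (hid.const_mul a).add_const b
  have hf2 : HasDerivAt (fun y : ℝ => (a * y + b) ^ 2) (2 * (a * x + b) * a) x := by
    simpa using hf.fun_pow 2
  have hf2' : (a * x + b) ^ 2 ≠ 0 := pow_ne_zero 2 hx1
  have hg := (hid.const_mul (2 * a)).div hf hx1
  have hm := (hasDerivAt_const x ((n : ℝ) - 1)).div hid hx0
  have hm' := (hasDerivAt_const x (2 * a * ((n : ℝ) - 1))).div hf hx1
  have hq := (hid.const_mul (2 * (2 * (n : ℝ) - 1) * a ^ 2)).div hf2 hf2'
  have hmu := (hid.const_mul mu).div hf2 hf2'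
  have hA := (((((hasDerivAt_const x (1 : ℝ)).sub hg).mul (hφ'' x hx)).add
    ((((hm.sub hm').sub (hg.mul hm)).add hq).mul (hφ' x hx))).add hmu).sub_const (r : ℝ)
  have hzero := hA.unique ((hasDerivAt_const x ctil).congr_of_eventuallyEq
    (Filter.eventually_of_mem (Ioo_mem_nhds hx.1 hx.2) hconst))
  have hα : 1 - 2 * a * x / (a * x + b) ≠ 0 := by
    have h : 1 - 2 * a * x / (a * x + b) = -(a * x - b) / (a * x + b) := by
      field_simp
      ring
    rw [h]
    exact div_ne_zero (neg_ne_zero.mpr hx2) hx1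
  refine (mul_eq_zero.mp ?_).resolve_left hα
  rw [← hzero]
  simp only [Pi.sub_apply, Pi.add_apply, Pi.mul_apply, Pi.div_apply]
  field_simp
  ring
end

section
/- Let n ≥ 2 be an integer and q, s, μ, γ real numbers. Let I be an open interval on which u ≠ 0, qu+s ≠ 0 and qu−s ≠ 0, and let G : ℝ → ℝ be twice differentiable on I satisfying, for all u ∈ I, the first-order equation G'(u) − ((2n−1)q/(qu+s) + q/(qu−s))·G(u) − (2μu^n − 2γu^(n−1)(qu+s)²)/((qu+s)(qu−s)) = 0. Then G also satisfies, for all u ∈ I, the second-order equation G''(u) − (2(n−1)q/(qu+s) + n/u)·G'(u) + (2n(n−1)q/(u(qu+s)))·G(u) + 2γu^(n−2) = 0. -/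
/-- Remark after Theorem 2.3: every solution `G` of the first-order ODE (2.26)
is automatically a solution of the second-order ODE (2.25). -/
theorem stmt8 (n : ℕ) (hn : 2 ≤ n) (q s mu γ : ℝ) (p₀ q₀ : ℝ)
    (hne0 : ∀ u ∈ Set.Ioo p₀ q₀, u ≠ 0)
    (hne1 : ∀ u ∈ Set.Ioo p₀ q₀, q * u + s ≠ 0)
    (hne2 : ∀ u ∈ Set.Ioo p₀ q₀, q * u - s ≠ 0)
    (G G' G'' : ℝ → ℝ)
    (hG' : ∀ u ∈ Set.Ioo p₀ q₀, HasDerivAt G (G' u) u)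
    (hG'' : ∀ u ∈ Set.Ioo p₀ q₀, HasDerivAt G' (G'' u) u)
    (hODE1 : ∀ u ∈ Set.Ioo p₀ q₀,
      G' u - ((2 * (n : ℝ) - 1) * q / (q * u + s) + q / (q * u - s)) * G u -
        (2 * mu * u ^ n - 2 * γ * u ^ (n - 1) * (q * u + s) ^ 2) /
          ((q * u + s) * (q * u - s)) = 0) :
    ∀ u ∈ Set.Ioo p₀ q₀,
      G'' u - (2 * ((n : ℝ) - 1) * q / (q * u + s) + (n : ℝ) / u) * G' u +
        (2 * (n : ℝ) * ((n : ℝ) - 1) * q / (u * (q * u + s))) * G u +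
        2 * γ * u ^ (n - 2) = 0 := by
  obtain ⟨m, rfl⟩ := Nat.exists_eq_add_of_le' hn
  have hcleared : ∀ v ∈ Set.Ioo p₀ q₀,
      (q * v + s) * (q * v - s) * G' v -
        ((2 * ((m + 2 : ℕ) : ℝ) - 1) * q * (q * v - s) + q * (q * v + s)) * G v -
        (2 * mu * v ^ (m + 2) - 2 * γ * v ^ (m + 1) * (q * v + s) ^ 2) = 0 := by
    intro v hv
    have h1 := hne1 v hv
    have h2 := hne2 v hv
    have h := hODE1 v hv
    rw [show m + 2 - 1 = m + 1 from rfl] at h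
    generalize q * v + s = A at *
    generalize q * v - s = B at *
    field_simp at h
    linear_combination h
  intro u hu
  have h0 := hne0 u hu
  have h1 := hne1 u hu
  have h2 := hne2 u hu
  have hA : HasDerivAt (fun v : ℝ => q * v + s) q u := by
    simpa using ((hasDerivAt_id u).const_mul q).add_const s
  have hB : HasDerivAt (fun v : ℝ => q * v - s) q u := by
    simpa using ((hasDerivAt_id u).const_mul q).sub_const s
  have hderiv := (((hA.mul hB).mul (hG'' u hu)).sub
    (((hB.const_mul ((2 * ((m + 2 : ℕ) : ℝ) - 1) * q)).add (hA.const_mul q)).mul (hG' u hu))).sub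
    (((hasDerivAt_pow (m + 2) u).const_mul (2 * mu)).sub
      (((hasDerivAt_pow (m + 1) u).const_mul (2 * γ)).mul (hA.pow 2)))
  have hzero := hderiv.unique ((hasDerivAt_const u (0 : ℝ)).congr_of_eventuallyEq
    (Filter.eventually_of_mem (isOpen_Ioo.mem_nhds hu) hcleared))
  have hE := hcleared u hu
  simp only [Pi.mul_apply, Pi.add_apply, Pi.pow_apply, Nat.add_sub_cancel,
    show m + 2 - 1 = m + 1 from rfl] at hzero ⊢
  push_cast at hzero hE ⊢
  have hne : u * ((q * u + s) * (q * u - s)) ≠ 0 := mul_ne_zero h0 (mul_ne_zero h1 h2)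
  refine (mul_eq_zero_iff_left hne).mp ?_
  have hclear : ∀ A B N g g' g'' w : ℝ, A ≠ 0 →
      u * (A * B) * (g'' - (2 * (N - 1) * q / A + N / u) * g' +
        2 * N * (N - 1) * q / (u * A) * g + w) =
      B * (u * A * g'' - (2 * (N - 1) * q * u + N * A) * g' +
        2 * N * (N - 1) * q * g + u * A * w) := by
    intro A B N g g' g'' w hA0
    field_simp
  rw [hclear _ _ _ _ _ _ _ h1]
  linear_combination u * hzero - ((m : ℝ) + 2) * hE
end

section
/- Let d ≥ 1 be an integer and μ ≤ 0 a real number, and define φ : ℝ → ℝ by φ(x) := ((μ+1)/(d+1))·(1−x−(1−x)^(d+2)) − (μ/(d+2))·(1−(1−x)^(d+2)). Then: (i) φ(0) = 0; (ii) φ has derivative 1 at x = 0; (iii) for every x ∈ (0,1), φ is differentiable at x with φ'(x) = (1−(μ+1)x)/(1−x) − ((d+2)/(1−x))·φ(x); (iv) φ(x) > 0 for every x ∈ (0,1); (v) φ(1) = −μ/(d+2). -/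
/-- Corollary 1.1 (formula (1.6)): the explicit momentum profile for
`a = λ = −1`, `b = ν = 1` satisfies the required boundary conditions, the
first-order ODE, and positivity on `(0,1)`. -/
theorem stmt10 (d : ℕ) (hd : 1 ≤ d) (mu : ℝ) (hmu : mu ≤ 0)
    (φ : ℝ → ℝ)
    (hφ : φ = fun x =>
      (mu + 1) / ((d : ℝ) + 1) * (1 - x - (1 - x) ^ (d + 2)) -
        mu / ((d : ℝ) + 2) * (1 - (1 - x) ^ (d + 2))) :
    φ 0 = 0 ∧ HasDerivAt φ 1 0 ∧
      (∀ x ∈ Set.Ioo (0 : ℝ) 1, HasDerivAt φ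
        ((1 - (mu + 1) * x) / (1 - x) - ((d : ℝ) + 2) / (1 - x) * φ x) x) ∧
      (∀ x ∈ Set.Ioo (0 : ℝ) 1, 0 < φ x) ∧
      φ 1 = -mu / ((d : ℝ) + 2) := by
  have hd1 : (d : ℝ) + 1 ≠ 0 := by positivity
  have hd2 : (d : ℝ) + 2 ≠ 0 := by positivity
  have hderiv : ∀ x, HasDerivAt φ
      ((mu + 1) / ((d : ℝ) + 1) * (-1 + ((d : ℝ) + 2) * (1 - x) ^ (d + 1)) -
        mu * (1 - x) ^ (d + 1)) x := by
    intro x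
    have hu : HasDerivAt (fun x : ℝ => 1 - x) (-1) x := (hasDerivAt_id' x).const_sub 1
    have hp : HasDerivAt (fun x : ℝ => (1 - x) ^ (d + 2))
        (-(((d : ℝ) + 2) * (1 - x) ^ (d + 1))) x := by
      refine (hu.fun_pow (d + 2)).congr_deriv ?_
      rw [show d + 2 - 1 = d + 1 by lia]
      push_cast
      ring
    rw [hφ]
    refine (((hu.fun_sub hp).const_mul ((mu + 1) / ((d : ℝ) + 1))).fun_sub
      ((hp.const_sub 1).const_mul (mu / ((d : ℝ) + 2)))).congr_deriv ?_
    field_simp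
    ring
  refine ⟨by simp [hφ], ?_, ?_, ?_, ?_⟩
  · convert hderiv 0 using 1
    simp only [sub_zero, one_pow]
    field_simp
    ring
  · rintro x ⟨-, hx1⟩
    have hx : 1 - x ≠ 0 := by linarith
    convert hderiv x using 1
    simp only [hφ]
    field_simp
    ring
  · rintro x ⟨hx0, hx1⟩
    have hpow : (1 - x) ^ (d + 2) < 1 - x :=
      pow_lt_self_of_lt_one₀ (by linarith) (by linarith) (by lia)
    have bernoulli : 1 - ((d : ℝ) + 2) * x ≤ (1 - x) ^ (d + 2) := by
      have h := one_add_mul_le_pow (a := -x) (by linarith) (d + 2)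
      push_cast at h
      rw [← sub_eq_add_neg 1 x] at h
      linarith
    have hsplit : φ x = (1 - x - (1 - x) ^ (d + 2)) / ((d : ℝ) + 1) +
        -mu * ((1 - x) ^ (d + 2) - (1 - ((d : ℝ) + 2) * x)) /
          (((d : ℝ) + 1) * ((d : ℝ) + 2)) := by
      simp only [hφ]
      field_simp
      ring
    rw [hsplit]
    exact add_pos_of_pos_of_nonneg (div_pos (by linarith) (by positivity))
      (div_nonneg (mul_nonneg (by linarith) (by linarith)) (by positivity))
  · simp [hφ, neg_div]
end

section
/- Let n ≥ 2 be an integer and a, μ real numbers with a < 0 and μ < 0. Then for every real x with 0 < x < −1/a: −μ·((1−ax)(1+ax)^(2n−1)/x^(n−1))·∫₀^x u^n/((1−au)²(1+au)^(2n)) du = −(μ/(n+1))·x² − (μ/a²)·Σ_{k=3}^{n+1} ((k−1)/(n+k−1))·(∏_{j=1}^{k−2} (n−j)/(n+j))·(ax)^k. -/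
/-- The product `∏_{j=1}^{m} (ν - j) / (ν + j)`. -/
noncomputable def fallingRatio (ν : ℝ) (m : ℕ) : ℝ :=
  ∏ j ∈ Finset.range m, (ν - 1 - j) / (ν + 1 + j)

theorem fallingRatio_succ (ν : ℝ) (m : ℕ) :
    fallingRatio ν (m + 1) = fallingRatio ν m * ((ν - 1 - m) / (ν + 1 + m)) :=
  Finset.prod_range_succ _ _

theorem fallingRatio_self_succ (s : ℕ) : fallingRatio ((s : ℝ) + 1) (s + 1) = 0 := by
  rw [fallingRatio_succ]
  simp

theorem fallingRatio_eq_prod_Icc (ν : ℝ) (m : ℕ) :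
    fallingRatio ν m = ∏ j ∈ Finset.Icc 1 m, (ν - (j : ℝ)) / (ν + (j : ℝ)) := by
  induction m with
  | zero => simp [fallingRatio]
  | succ m ih =>
    rw [fallingRatio_succ, ih, Finset.prod_Icc_succ_top (by omega)]
    push_cast
    congr 2 <;> ring

/-- The coefficient of `t ^ (m + 2)` in the momentum profile. -/
noncomputable def profileCoeff (ν : ℝ) (m : ℕ) : ℝ :=
  ((m : ℝ) + 1) / (ν + 1 + m) * fallingRatio ν m

theorem sum_profileCoeff_ode (ν : ℝ) (hν : 0 ≤ ν) (t : ℝ) (M : ℕ) :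
    (1 - t ^ 2) * ((ν - 1) * ∑ m ∈ Finset.range M, profileCoeff ν m * t ^ (m + 2) +
        t * ∑ m ∈ Finset.range M, profileCoeff ν m * (((m : ℝ) + 2) * t ^ (m + 1))) -
      t * (2 * ν - 2 - 2 * ν * t) * ∑ m ∈ Finset.range M, profileCoeff ν m * t ^ (m + 2) =
    t ^ 2 - ((M : ℝ) + 1) * fallingRatio ν M * t ^ (M + 2) +
      M * fallingRatio ν M * t ^ (M + 3) := by
  induction M with
  | zero => simp [fallingRatio]
  | succ M ih =>
    have h : ν + 1 + M ≠ 0 := by positivity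
    have key : (1 - t ^ 2) * ((ν - 1) * (profileCoeff ν M * t ^ (M + 2)) +
          t * (profileCoeff ν M * (((M : ℝ) + 2) * t ^ (M + 1)))) -
        t * (2 * ν - 2 - 2 * ν * t) * (profileCoeff ν M * t ^ (M + 2)) =
        (((M : ℝ) + 1) * fallingRatio ν M * t ^ (M + 2) - M * fallingRatio ν M * t ^ (M + 3)) -
        (((M : ℝ) + 2) * fallingRatio ν (M + 1) * t ^ (M + 3) -
          (M + 1) * fallingRatio ν (M + 1) * t ^ (M + 4)) := by
      rw [fallingRatio_succ, profileCoeff]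
      field_simp
      ring
    rw [Finset.sum_range_succ, Finset.sum_range_succ]
    push_cast
    linear_combination ih + key

theorem hasDerivAt_sum_profileCoeff (ν a u : ℝ) (M : ℕ) :
    HasDerivAt (fun u : ℝ => ∑ m ∈ Finset.range M, profileCoeff ν m * (a * u) ^ (m + 2))
      (a * ∑ m ∈ Finset.range M, profileCoeff ν m * (((m : ℝ) + 2) * (a * u) ^ (m + 1))) u := by
  rw [Finset.mul_sum]
  refine HasDerivAt.fun_sum fun m _ => ?_
  have h := ((((hasDerivAt_id u).const_mul a).pow (m + 2)).const_mul (profileCoeff ν m))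
  refine h.congr_deriv ?_
  simp
  ring

theorem hasDerivAt_profile_primitive (s : ℕ) (hs : 1 ≤ s) (a u : ℝ) (ha : a ≠ 0)
    (h1 : 1 - a * u ≠ 0) (h2 : 1 + a * u ≠ 0) :
    HasDerivAt (fun u : ℝ => u ^ s *
        (∑ m ∈ Finset.range (s + 1), profileCoeff ((s : ℝ) + 1) m * (a * u) ^ (m + 2)) /
        (a ^ 2 * ((1 - a * u) * (1 + a * u) ^ (2 * s + 1))))
      (u ^ (s + 1) / ((1 - a * u) ^ 2 * (1 + a * u) ^ (2 * (s + 1)))) u := by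
  obtain ⟨r, rfl⟩ : ∃ r, s = r + 1 := ⟨s - 1, by omega⟩
  have hP := hasDerivAt_sum_profileCoeff (((r + 1 : ℕ) : ℝ) + 1) a u (r + 1 + 1)
  have hode := sum_profileCoeff_ode (((r + 1 : ℕ) : ℝ) + 1) (by positivity) (a * u) (r + 1 + 1)
  rw [fallingRatio_self_succ] at hode
  have hl := (hasDerivAt_id u).const_mul a
  have hD := ((hl.const_sub 1).mul ((hl.const_add 1).pow (2 * (r + 1) + 1))).const_mul (a ^ 2)
  have hF := (((hasDerivAt_id u).pow (r + 1)).mul hP).div hD (by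
    simp only [Pi.mul_apply, Pi.pow_apply, id]
    positivity)
  refine hF.congr_deriv ?_
  simp only [Pi.mul_apply, Pi.pow_apply, id] at hode ⊢
  generalize (∑ m ∈ Finset.range (r + 1 + 1),
    profileCoeff (((r + 1 : ℕ) : ℝ) + 1) m * (a * u) ^ (m + 2)) = P at hode ⊢
  generalize (∑ m ∈ Finset.range (r + 1 + 1),
    profileCoeff (((r + 1 : ℕ) : ℝ) + 1) m * (((m : ℝ) + 2) * (a * u) ^ (m + 1))) = D at hode ⊢
  push_cast at hode ⊢
  rw [div_eq_div_iff (by positivity) (by positivity)]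
  linear_combination (a ^ 2 * u ^ r * (1 + a * u) ^ (2 * r + 2) * (1 - a * u) ^ 2 *
    (1 + a * u) ^ (2 * r + 4)) * hode

theorem integral_eq_profile (s : ℕ) (hs : 1 ≤ s) (a x : ℝ) (ha : a < 0)
    (hx0 : 0 < x) (hx1 : x < -1 / a) :
    ∫ u in (0:ℝ)..x, u ^ (s + 1) / ((1 - a * u) ^ 2 * (1 + a * u) ^ (2 * (s + 1))) =
      x ^ s *
        (∑ m ∈ Finset.range (s + 1), profileCoeff ((s : ℝ) + 1) m * (a * x) ^ (m + 2)) /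
        (a ^ 2 * ((1 - a * x) * (1 + a * x) ^ (2 * s + 1))) := by
  have hpos : ∀ u ∈ Set.uIcc 0 x, 1 - a * u ≠ 0 ∧ 1 + a * u ≠ 0 := by
    intro u hu
    rw [Set.uIcc_of_le hx0.le] at hu
    have h : -1 < a * x := by
      rw [lt_div_iff_of_neg ha] at hx1
      linarith
    constructor <;> nlinarith [hu.1, hu.2]
  rw [intervalIntegral.integral_eq_sub_of_hasDerivAt
    (fun u hu => hasDerivAt_profile_primitive s hs a u ha.ne (hpos u hu).1 (hpos u hu).2)]
  · simp
  · refine ContinuousOn.intervalIntegrable (ContinuousOn.div (by fun_prop) (by fun_prop) ?_)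
    intro u hu
    have := hpos u hu
    exact mul_ne_zero (pow_ne_zero _ this.1) (pow_ne_zero _ this.2)


/-- Formula (1.13) of Corollary 1.3: explicit polynomial evaluation of the
momentum profile on the punctured disc bundle over a Ricci-flat base. -/
theorem stmt11 (n : ℕ) (hn : 2 ≤ n) (a mu : ℝ) (ha : a < 0) (hmu : mu < 0)
    (x : ℝ) (hx0 : 0 < x) (hx1 : x < -1 / a) :
    -mu * ((1 - a * x) * (1 + a * x) ^ (2 * n - 1) / x ^ (n - 1)) *
        ∫ u in (0:ℝ)..x, u ^ n / ((1 - a * u) ^ 2 * (1 + a * u) ^ (2 * n)) =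
      -(mu / ((n : ℝ) + 1)) * x ^ 2 -
        mu / a ^ 2 *
          ∑ k ∈ Finset.Icc 3 (n + 1),
            ((k : ℝ) - 1) / ((n : ℝ) + (k : ℝ) - 1) *
              (∏ j ∈ Finset.Icc 1 (k - 2), ((n : ℝ) - (j : ℝ)) / ((n : ℝ) + (j : ℝ))) *
              (a * x) ^ k := by
  obtain ⟨s, rfl⟩ : ∃ s, n = s + 1 := ⟨n - 1, by omega⟩
  have hs : 1 ≤ s := by omega
  have hax : -1 < a * x := by
    rw [lt_div_iff_of_neg ha] at hx1
    linarith
  have hax' : a * x < 0 := mul_neg_of_neg_of_pos ha hx0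
  have h1 : 1 - a * x ≠ 0 := by linarith
  have h2 : 1 + a * x ≠ 0 := by linarith
  have hsum : ∑ k ∈ Finset.Icc 3 (s + 1 + 1),
      ((k : ℝ) - 1) / (((s + 1 : ℕ) : ℝ) + (k : ℝ) - 1) *
        (∏ j ∈ Finset.Icc 1 (k - 2),
          (((s + 1 : ℕ) : ℝ) - (j : ℝ)) / (((s + 1 : ℕ) : ℝ) + (j : ℝ))) * (a * x) ^ k =
      ∑ m ∈ Finset.range s, profileCoeff ((s : ℝ) + 1) (m + 1) * (a * x) ^ (m + 1 + 2) := by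
    rw [← Finset.Ico_add_one_right_eq_Icc, Finset.sum_Ico_eq_sum_range]
    refine Finset.sum_congr (by congr 1) fun m _ => ?_
    rw [← fallingRatio_eq_prod_Icc, profileCoeff, show 3 + m - 2 = m + 1 by omega,
      show 3 + m = m + 1 + 2 by omega]
    push_cast
    congr 3 <;> ring
  rw [hsum, integral_eq_profile s hs a x ha hx0 hx1, Finset.sum_range_succ',
    show 2 * (s + 1) - 1 = 2 * s + 1 by omega, Nat.add_sub_cancel]
  have h0 : profileCoeff ((s : ℝ) + 1) 0 = 1 / ((s : ℝ) + 1 + 1) := by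
    simp [profileCoeff, fallingRatio]
  rw [h0]
  have ha0 := ha.ne
  have hs2 : (s : ℝ) + 1 + 1 ≠ 0 := by positivity
  generalize ∑ m ∈ Finset.range s,
    profileCoeff ((s : ℝ) + 1) (m + 1) * (a * x) ^ (m + 1 + 2) = T
  push_cast
  field_simp
  ring
end

section
/- Let d ≥ 1 be an integer and a, b, λ, ν, μ real numbers with a < 0. Set c := −b/a and assume ν+λc > 0. Let x0 < c be a real number such that for all x ∈ [x0, c]: ν+λx > 0 and aλx+2aν−bλ ≠ 0. Set γ := μ(ν+λx0)/(b+ax0)² and define for x ∈ [x0, c): φ(x) := ((ax+b)^(2d+1)·(aλx+2aν−bλ)/(ν+λx)^d) · ∫_{x0}^x (ν+λu)^d·(μ(ν+λu) − γ(au+b)²) / ((au+b)^(2d+2)·(aλu+2aν−bλ)²) du. Then φ(x) tends to −μ/(2(2d+1)a²) as x tends to c from the left. -/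
open Topology

lemma continuousOn_div_sub_pow {g : ℝ → ℝ} {c x y : ℝ} (n : ℕ) (hy : y < c)
    (hg : ContinuousOn g (Set.Icc x y)) :
    ContinuousOn (fun u => g u / (c - u) ^ n) (Set.Icc x y) :=
  hg.div (by fun_prop) fun u hu => pow_ne_zero _ (by linarith [hu.2])

/-- The integral of `(c - u)⁻ⁿ⁻¹` over an interval to the left of `c`. -/
lemma integral_one_div_sub_pow {c x y : ℝ} {n : ℕ} (hn : n ≠ 0) (hxy : x ≤ y) (hy : y < c) :
    ∫ u in x..y, 1 / (c - u) ^ (n + 1) = (1 / (c - y) ^ n - 1 / (c - x) ^ n) / n := by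
  have hn' : (n : ℝ) ≠ 0 := Nat.cast_ne_zero.mpr hn
  rw [intervalIntegral.integral_eq_sub_of_hasDerivAt (f := fun u => 1 / (c - u) ^ n / n)]
  · ring
  · intro u hu
    rw [Set.uIcc_of_le hxy] at hu
    have hu' : c - u ≠ 0 := by linarith [hu.2]
    have h := ((((hasDerivAt_id u).const_sub c).pow n).inv (pow_ne_zero n hu')).div_const (n : ℝ)
    obtain ⟨m, rfl⟩ := Nat.exists_eq_succ_of_ne_zero hn
    convert! h using 1
    · ext v
      simp
    · simp only [id, Nat.succ_eq_add_one, Nat.add_sub_cancel, Pi.pow_apply]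
      field_simp
      ring
  · exact ContinuousOn.intervalIntegrable_of_Icc hxy
      (continuousOn_div_sub_pow (n + 1) hy continuousOn_const)

/-- The leading asymptotics at `c` of the divergent integral of `g u / (c - u) ^ (n + 1)`. -/
lemma tendsto_sub_pow_mul_integral {g : ℝ → ℝ} {c x₀ : ℝ} {n : ℕ} (hn : n ≠ 0) (hx₀ : x₀ < c)
    (hg : ContinuousOn g (Set.Icc x₀ c)) :
    Filter.Tendsto (fun x => (c - x) ^ n * ∫ u in x₀..x, g u / (c - u) ^ (n + 1))
      (𝓝[<] c) (𝓝 (g c / n)) := by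
  have hn' : (1 : ℝ) ≤ n := by exact_mod_cast Nat.one_le_iff_ne_zero.mpr hn
  rw [Metric.tendsto_nhds]
  intro ε hε
  obtain ⟨δ, hδ, hgδ⟩ := Metric.continuousWithinAt_iff.mp
    (hg c (Set.right_mem_Icc.mpr hx₀.le)) (ε / 2) (half_pos hε)
  obtain ⟨y, hy, hyc⟩ : ∃ y, max x₀ (c - δ) < y ∧ y < c :=
    exists_between (max_lt hx₀ (by linarith))
  obtain ⟨hx₀y, hδy⟩ := max_lt_iff.mp hy
  set K := (∫ u in x₀..y, g u / (c - u) ^ (n + 1)) - g c * (1 / (c - y) ^ n) / n with hK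
  have hsmall : ∀ᶠ x in 𝓝[<] c, |(c - x) ^ n * K| < ε / 2 := by
    have h : ContinuousAt (fun x => |(c - x) ^ n * K|) c := by fun_prop
    refine (h.eventually_lt continuousAt_const ?_).filter_mono nhdsWithin_le_nhds
    simpa [hn] using hε
  filter_upwards [hsmall, Ioo_mem_nhdsLT hyc] with x hx hxy
  obtain ⟨hyx, hxc⟩ := hxy
  have hint : ∀ {f : ℝ → ℝ} {s t : ℝ}, ContinuousOn f (Set.Icc x₀ c) → x₀ ≤ s → s ≤ t → t < c →
      IntervalIntegrable (fun u => f u / (c - u) ^ (n + 1)) MeasureTheory.volume s t :=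
    fun hf hs hst ht => ContinuousOn.intervalIntegrable_of_Icc hst
      (continuousOn_div_sub_pow _ ht (hf.mono (Set.Icc_subset_Icc hs ht.le)))
  have hgy := hint hg hx₀y.le hyx.le hxc
  have h1 := hint (f := fun _ => 1) continuousOn_const hx₀y.le hyx.le hxc
  have hpow : 0 < (c - x) ^ n := pow_pos (by linarith) n
  have hone := integral_one_div_sub_pow hn hyx.le hxc
  have hbound : |(∫ u in y..x, g u / (c - u) ^ (n + 1)) -
      g c * ((1 / (c - x) ^ n - 1 / (c - y) ^ n) / n)| ≤
      ε / 2 * ((1 / (c - x) ^ n - 1 / (c - y) ^ n) / n) := by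
    rw [← hone, ← intervalIntegral.integral_const_mul, ← intervalIntegral.integral_const_mul,
      ← intervalIntegral.integral_sub hgy (h1.const_mul _), ← Real.norm_eq_abs]
    refine intervalIntegral.norm_integral_le_of_norm_le hyx.le
      (Filter.Eventually.of_forall fun u hu => ?_) (h1.const_mul _)
    have hd : |g u - g c| < ε / 2 := by
      refine hgδ ⟨by linarith [hu.1], by linarith [hu.2]⟩ ?_
      rw [Real.dist_eq, abs_lt]
      constructor <;> linarith [hu.1, hu.2]
    have hp : 0 < (c - u) ^ (n + 1) := pow_pos (by linarith [hu.2]) _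
    rw [Real.norm_eq_abs, mul_one_div, mul_one_div, ← sub_div, abs_div, abs_of_pos hp]
    gcongr
  have hsplit := intervalIntegral.integral_add_adjacent_intervals
    (hint hg le_rfl hx₀y.le hyc) hgy
  have htail : |(c - x) ^ n * ((∫ u in y..x, g u / (c - u) ^ (n + 1)) -
      g c * ((1 / (c - x) ^ n - 1 / (c - y) ^ n) / n))| ≤ ε / 2 := by
    have hle : (1 / (c - x) ^ n - 1 / (c - y) ^ n) / n ≤ 1 / (c - x) ^ n := by
      have : 0 < 1 / (c - y) ^ n := one_div_pos.mpr (pow_pos (by linarith) n)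
      have : 0 < 1 / (c - x) ^ n := one_div_pos.mpr hpow
      rw [div_le_iff₀ (by linarith)]
      nlinarith
    rw [abs_mul, abs_of_pos hpow]
    calc _ ≤ (c - x) ^ n * (ε / 2 * (1 / (c - x) ^ n)) := by gcongr; exact hbound.trans (by gcongr)
      _ = ε / 2 := by field_simp
  have heq : (c - x) ^ n * (∫ u in x₀..x, g u / (c - u) ^ (n + 1)) - g c / n =
      (c - x) ^ n * K + (c - x) ^ n * ((∫ u in y..x, g u / (c - u) ^ (n + 1)) -
        g c * ((1 / (c - x) ^ n - 1 / (c - y) ^ n) / n)) := by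
    rw [← hsplit, hK]
    field_simp
    ring
  rw [Real.dist_eq, heq]
  exact (abs_add_le _ _).trans_lt (by linarith)

/-- Endpoint limit in part (II-i-1) of the proof of Theorem 4.2:
`φ(x) → −μ/(2(2d+1)a²)` as `x → c⁻`, where `c = −b/a`. -/
theorem stmt13 (d : ℕ) (hd : 1 ≤ d) (a b lam nu mu : ℝ) (ha : a < 0)
    (c : ℝ) (hc : c = -b / a) (hnlc : 0 < nu + lam * c)
    (x0 : ℝ) (hx0 : x0 < c)
    (hpos : ∀ x ∈ Set.Icc x0 c, 0 < nu + lam * x)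
    (hne : ∀ x ∈ Set.Icc x0 c, a * lam * x + 2 * a * nu - b * lam ≠ 0)
    (γ : ℝ) (hγ : γ = mu * (nu + lam * x0) / (b + a * x0) ^ 2)
    (φ : ℝ → ℝ)
    (hφ : ∀ x ∈ Set.Ico x0 c, φ x =
      (a * x + b) ^ (2 * d + 1) * (a * lam * x + 2 * a * nu - b * lam) / (nu + lam * x) ^ d *
        ∫ u in x0..x,
          (nu + lam * u) ^ d * (mu * (nu + lam * u) - γ * (a * u + b) ^ 2) /
            ((a * u + b) ^ (2 * d + 2) * (a * lam * u + 2 * a * nu - b * lam) ^ 2)) :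
    Filter.Tendsto φ (𝓝[<] c) (𝓝 (-mu / (2 * (2 * (d : ℝ) + 1) * a ^ 2))) := by
  have hb : b = -a * c := by
    have ha₀ := ha.ne
    rw [hc]
    field_simp
  have hlin : ∀ u, a * u + b = -a * (c - u) := fun u => by rw [hb]; ring
  set g : ℝ → ℝ := fun u => (nu + lam * u) ^ d * (mu * (nu + lam * u) - γ * (a * u + b) ^ 2) /
    ((-a) ^ (2 * d + 2) * (a * lam * u + 2 * a * nu - b * lam) ^ 2) with hg
  have hgcont : ContinuousOn g (Set.Icc x0 c) :=
    ContinuousOn.div (by fun_prop) (by fun_prop) fun u hu =>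
      mul_ne_zero (pow_ne_zero _ (neg_ne_zero.mpr ha.ne)) (pow_ne_zero _ (hne u hu))
  have hlim := tendsto_sub_pow_mul_integral (n := 2 * d + 1) (by omega) hx0 hgcont
  have hpre : ContinuousAt (fun x => (-a) ^ (2 * d + 1) *
      (a * lam * x + 2 * a * nu - b * lam) / (nu + lam * x) ^ d) c :=
    ContinuousAt.div (by fun_prop) (by fun_prop) (pow_ne_zero _ hnlc.ne')
  have hval : (-a) ^ (2 * d + 1) * (a * lam * c + 2 * a * nu - b * lam) / (nu + lam * c) ^ d *
      (g c / (2 * d + 1 : ℕ)) = -mu / (2 * (2 * (d : ℝ) + 1) * a ^ 2) := by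
    have hfac : a * lam * c + 2 * a * nu - b * lam = 2 * a * (nu + lam * c) := by rw [hb]; ring
    have ha' : -a ≠ 0 := neg_ne_zero.mpr ha.ne
    have hd' : (2 * (d : ℝ) + 1) ≠ 0 := by positivity
    simp only [hg]
    rw [hfac, hlin c, sub_self, pow_succ (-a) (2 * d + 1)]
    have hN := hnlc.ne'
    generalize nu + lam * c = N at hN ⊢
    have hP := pow_ne_zero (2 * d + 1) ha'
    generalize (-a) ^ (2 * d + 1) = P at hP ⊢
    push_cast
    field_simp
    ring
  rw [← hval]
  refine ((hpre.tendsto.mono_left nhdsWithin_le_nhds).mul hlim).congr' ?_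
  filter_upwards [Ioo_mem_nhdsLT hx0] with x hx
  have hintegrand : ∀ u, g u / (c - u) ^ (2 * d + 1 + 1) =
      (nu + lam * u) ^ d * (mu * (nu + lam * u) - γ * (a * u + b) ^ 2) /
        ((a * u + b) ^ (2 * d + 2) * (a * lam * u + 2 * a * nu - b * lam) ^ 2) := fun u => by
    rw [hg, div_div, show (a * u + b) ^ (2 * d + 2) = (-a) ^ (2 * d + 2) * (c - u) ^ (2 * d + 2) by
      rw [hlin, mul_pow]]
    congr 1
    ring
  rw [hφ x ⟨hx.1.le, hx.2⟩]
  simp only [hintegrand]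
  rw [show (a * x + b) ^ (2 * d + 1) = (-a) ^ (2 * d + 1) * (c - x) ^ (2 * d + 1) by
    rw [hlin, mul_pow]]
  ring
end

section
/- Let d ≥ 1 be an integer and a, b, λ, ν, μ real numbers, and let x0 be a real number with ax0+b > 0, ν+λx0 > 0 and aλx0+2aν−bλ ≠ 0. Choose an open interval I containing x0 on which ax+b > 0, ν+λx > 0 and aλx+2aν−bλ ≠ 0, set γ := μ(ν+λx0)/(b+ax0)², and define for x ∈ I: φ(x) := ((ax+b)^(2d+1)·(aλx+2aν−bλ)/(ν+λx)^d) · ∫_{x0}^x (ν+λu)^d·(μ(ν+λu) − γ(au+b)²) / ((au+b)^(2d+2)·(aλu+2aν−bλ)²) du. Then φ(x)/(x−x0)² tends to −μ/(2(b+ax0)²) as x tends to x0 with x ≠ x0. -/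
open Topology

open Filter in
/-- If `f` is continuous near `c`, vanishes at `c` and has derivative `f'` there, then
`∫ u in c..x, f u` is asymptotically `f' / 2 * (x - c) ^ 2`. -/
theorem tendsto_integral_div_sq {f : ℝ → ℝ} {f' c : ℝ} (hf : ∀ᶠ x in 𝓝 c, ContinuousAt f x)
    (hc : f c = 0) (hf' : HasDerivAt f f' c) :
    Tendsto (fun x => (∫ u in c..x, f u) / (x - c) ^ 2) (𝓝[≠] c) (𝓝 (f' / 2)) := by
  obtain ⟨ε, hε, hball⟩ := Metric.eventually_nhds_iff_ball.1 hf
  have hcont : ContinuousOn f (Metric.ball c ε) := fun x hx => (hball x hx).continuousWithinAt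
  have hderiv : ∀ x ∈ Metric.ball c ε, HasDerivAt (fun x => ∫ u in c..x, f u) (f x) x := by
    intro x hx
    refine intervalIntegral.integral_hasDerivAt_right ?_
      (hcont.stronglyMeasurableAtFilter Metric.isOpen_ball x hx) (hball x hx)
    exact (hcont.mono ((convex_ball c ε).ordConnected.uIcc_subset
      (Metric.mem_ball_self hε) hx)).intervalIntegrable
  have hnear : ∀ᶠ x in 𝓝[≠] c, x ∈ Metric.ball c ε :=
    mem_nhdsWithin_of_mem_nhds (Metric.ball_mem_nhds c hε)
  refine HasDerivAt.lhopital_zero_nhdsNE (f' := f) (g' := fun x => 2 * (x - c))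
    (hnear.mono hderiv) (.of_forall fun x => ?_) ?_ ?_ ?_ ?_
  · simpa using ((hasDerivAt_id x).sub_const c).fun_pow 2
  · filter_upwards [self_mem_nhdsWithin] with x hx
    exact mul_ne_zero two_ne_zero (sub_ne_zero.2 hx)
  · have h := (hderiv c (Metric.mem_ball_self hε)).continuousAt.tendsto
    rw [intervalIntegral.integral_same] at h
    exact h.mono_left nhdsWithin_le_nhds
  · have h : Continuous fun x : ℝ => (x - c) ^ 2 := by fun_prop
    simpa using (h.tendsto c).mono_left nhdsWithin_le_nhds
  · refine (hf'.tendsto_slope.div_const 2).congr fun x => ?_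
    rw [slope_def_field, hc, sub_zero, div_div, mul_comm]

/-- Quadratic vanishing rate in part (II-i-1) of the proof of Theorem 4.2:
`φ(x)/(x−x0)² → −μ/(2(b+ax0)²)` as `x → x0`, `x ≠ x0`. -/
theorem stmt14 (d : ℕ) (hd : 1 ≤ d) (a b lam nu mu x0 : ℝ)
    (hb0 : 0 < a * x0 + b) (hn0 : 0 < nu + lam * x0)
    (hne0 : a * lam * x0 + 2 * a * nu - b * lam ≠ 0)
    (p q : ℝ) (hp : p < x0) (hq : x0 < q)
    (hpos1 : ∀ x ∈ Set.Ioo p q, 0 < a * x + b)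
    (hpos2 : ∀ x ∈ Set.Ioo p q, 0 < nu + lam * x)
    (hne : ∀ x ∈ Set.Ioo p q, a * lam * x + 2 * a * nu - b * lam ≠ 0)
    (γ : ℝ) (hγ : γ = mu * (nu + lam * x0) / (b + a * x0) ^ 2)
    (φ : ℝ → ℝ)
    (hφ : ∀ x ∈ Set.Ioo p q, φ x =
      (a * x + b) ^ (2 * d + 1) * (a * lam * x + 2 * a * nu - b * lam) / (nu + lam * x) ^ d *
        ∫ u in x0..x,
          (nu + lam * u) ^ d * (mu * (nu + lam * u) - γ * (a * u + b) ^ 2) /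
            ((a * u + b) ^ (2 * d + 2) * (a * lam * u + 2 * a * nu - b * lam) ^ 2)) :
    Filter.Tendsto (fun x => φ x / (x - x0) ^ 2) (𝓝[≠] x0)
      (𝓝 (-mu / (2 * (b + a * x0) ^ 2))) := by
  have hA : a * x0 + b ≠ 0 := hb0.ne'
  have hI : ∀ᶠ x in 𝓝 x0, x ∈ Set.Ioo p q := Ioo_mem_nhds hp hq
  set f : ℝ → ℝ := fun u => (nu + lam * u) ^ d * (mu * (nu + lam * u) - γ * (a * u + b) ^ 2) /
    ((a * u + b) ^ (2 * d + 2) * (a * lam * u + 2 * a * nu - b * lam) ^ 2) with hf_def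
  set P : ℝ → ℝ := fun x => (a * x + b) ^ (2 * d + 1) *
    (a * lam * x + 2 * a * nu - b * lam) / (nu + lam * x) ^ d with hP_def
  have hden : ∀ x ∈ Set.Ioo p q,
      (a * x + b) ^ (2 * d + 2) * (a * lam * x + 2 * a * nu - b * lam) ^ 2 ≠ 0 := fun x hx =>
    mul_ne_zero (pow_ne_zero _ (hpos1 x hx).ne') (pow_ne_zero _ (hne x hx))
  have hf_cont : ∀ᶠ x in 𝓝 x0, ContinuousAt f x := by
    filter_upwards [hI] with x hx
    exact ContinuousAt.div (by fun_prop) (by fun_prop) (hden x hx)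
  have hzero : mu * (nu + lam * x0) - γ * (a * x0 + b) ^ 2 = 0 := by
    rw [hγ, add_comm b, div_mul_cancel₀ _ (pow_ne_zero 2 hA), sub_self]
  -- `f` is a product whose second factor vanishes at `x0`, so only that factor is differentiated.
  set k : ℝ → ℝ := fun u => (nu + lam * u) ^ d /
    ((a * u + b) ^ (2 * d + 2) * (a * lam * u + 2 * a * nu - b * lam) ^ 2) with hk_def
  have hk : DifferentiableAt ℝ k x0 :=
    DifferentiableAt.div (by fun_prop) (by fun_prop) (hden x0 ⟨hp, hq⟩)
  have hm : HasDerivAt (fun u => mu * (nu + lam * u) - γ * (a * u + b) ^ 2)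
      (mu * lam - γ * (2 * (a * x0 + b) * a)) x0 := by
    have hN : HasDerivAt (fun u => nu + lam * u) lam x0 := by
      simpa using ((hasDerivAt_id x0).const_mul lam).const_add nu
    have hL : HasDerivAt (fun u => a * u + b) a x0 := by
      simpa using ((hasDerivAt_id x0).const_mul a).add_const b
    simpa using (hN.const_mul mu).fun_sub ((hL.fun_pow 2).const_mul γ)
  have hf' : HasDerivAt f (k x0 * (mu * lam - γ * (2 * (a * x0 + b) * a))) x0 := by
    have h := hk.hasDerivAt.mul hm
    rw [hzero, mul_zero, zero_add] at h
    refine h.congr_of_eventuallyEq (.of_forall fun u => ?_)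
    simp only [hf_def, hk_def, Pi.mul_apply]
    ring
  have hP : Filter.Tendsto P (𝓝[≠] x0) (𝓝 (P x0)) := by
    have h : ContinuousAt P x0 :=
      ContinuousAt.div (by fun_prop) (by fun_prop) (pow_ne_zero _ hn0.ne')
    exact h.tendsto.mono_left nhdsWithin_le_nhds
  have hlim := hP.mul (tendsto_integral_div_sq hf_cont (by simp [hf_def, hzero]) hf')
  have hval : P x0 * (k x0 * (mu * lam - γ * (2 * (a * x0 + b) * a)) / 2) =
      -mu / (2 * (b + a * x0) ^ 2) := by
    have hslope : mu * lam - γ * (2 * (a * x0 + b) * a) =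
        -mu * (a * lam * x0 + 2 * a * nu - b * lam) / (a * x0 + b) := by
      rw [eq_div_iff hA]
      linear_combination 2 * a * hzero
    rw [hslope, add_comm b]
    simp only [hP_def, hk_def]
    have hN := hn0.ne'
    generalize a * lam * x0 + 2 * a * nu - b * lam = E at *
    generalize a * x0 + b = A at *
    generalize nu + lam * x0 = N at *
    field_simp
    ring
  rw [hval] at hlim
  refine hlim.congr' ?_
  filter_upwards [nhdsWithin_le_nhds hI] with x hx
  rw [hφ x hx, mul_div_assoc]
end

section
/- Let d ≥ 1 be an integer and a, b, λ, ν, μ real numbers with a < 0 and λ < 0, and let x1 be a real number such that for all x ≤ x1: ax+b > 0, ν+λx > 0 and aλx+2aν−bλ ≠ 0. Then: (i) for every x ≤ x1 the function u ↦ μ(ν+λu)^(d+1)/((b+au)^(2d+2)·(aλu+2aν−bλ)²) is integrable on (−∞, x]; and (ii) defining φ(x) := ((b+ax)^(2d+1)·(aλx+2aν−bλ)/(ν+λx)^d) · ∫_{−∞}^x μ(ν+λu)^(d+1)/((b+au)^(2d+2)·(aλu+2aν−bλ)²) du, the function φ tends to −μ/((d+2)a²) as x tends to −∞. -/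
open MeasureTheory

open Filter Topology in
/-- An affine function is asymptotic to its linear part. -/
theorem tendsto_affine_div_atBot (p q : ℝ) :
    Tendsto (fun x : ℝ => (p * x + q) / x) atBot (𝓝 p) := by
  have h : Tendsto (fun x : ℝ => p + q * x⁻¹) atBot (𝓝 (p + q * 0)) :=
    (tendsto_inv_atBot_zero.const_mul q).const_add p
  rw [mul_zero, add_zero] at h
  refine h.congr' ?_
  filter_upwards [eventually_lt_atBot 0] with x hx
  have := hx.ne
  field_simp

open Filter Topology Asymptotics in
/-- A function continuous on `(-∞, c]` and of order `x ^ (-(n + 1))` at `-∞`, with `1 ≤ n`, is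
integrable on `(-∞, c]`. -/
theorem integrableOn_Iic_of_tendsto_pow_mul {f : ℝ → ℝ} {c C : ℝ} {n : ℕ} (hn : 1 ≤ n)
    (hf : ContinuousOn f (Set.Iic c))
    (hC : Tendsto (fun x => x ^ (n + 1) * f x) atBot (𝓝 C)) :
    IntegrableOn f (Set.Iic c) := by
  refine (hf.locallyIntegrableOn measurableSet_Iic).integrableOn_of_isBigO_atBot
    (g := fun x : ℝ => (1 + x ^ 2)⁻¹) ?_ (integrable_inv_one_add_sq.integrableAtFilter _)
  have hpow : (fun x : ℝ => (x ^ (n + 1))⁻¹) =O[atBot] fun x : ℝ => (1 + x ^ 2)⁻¹ := by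
    refine IsBigO.of_bound 2 ?_
    filter_upwards [eventually_le_atBot (-1)] with x hx
    have hx1 : 1 ≤ |x| := by rw [abs_of_neg (by linarith)]; linarith
    have h2 : |x| ^ 2 ≤ |x| ^ (n + 1) := pow_le_pow_right₀ hx1 (by omega)
    have h1 : 1 ≤ |x| ^ 2 := one_le_pow₀ hx1
    rw [norm_inv, norm_inv, norm_pow, Real.norm_eq_abs, Real.norm_eq_abs,
      abs_of_pos (by positivity : 0 < 1 + x ^ 2), ← sq_abs x, ← div_eq_mul_inv,
      inv_le_comm₀ (by positivity) (by positivity), inv_div]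
    linarith
  refine ((hC.isBigO_one ℝ).mul hpow).congr' ?_ (by simp)
  filter_upwards [eventually_lt_atBot 0] with x hx
  have := hx.ne
  field_simp

open Filter Topology in
/-- Integrating an asymptotic equivalent `C * x ^ (-(n + 1))` at `-∞`. -/
theorem tendsto_pow_mul_integral_Iic {f : ℝ → ℝ} {c C : ℝ} {n : ℕ} (hn : 1 ≤ n)
    (hf : ContinuousOn f (Set.Iic c))
    (hC : Tendsto (fun x => x ^ (n + 1) * f x) atBot (𝓝 C)) :
    Tendsto (fun x => x ^ n * ∫ u in Set.Iic x, f u) atBot (𝓝 (-C / n)) := by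
  have hint := integrableOn_Iic_of_tendsto_pow_mul hn hf hC
  have hn0 : (n : ℝ) ≠ 0 := by positivity
  have hprim : ∀ x ≤ c,
      (∫ u in Set.Iic c, f u) + (∫ u in c..x, f u) = ∫ u in Set.Iic x, f u := by
    intro x hx
    rw [← intervalIntegral.integral_Iic_sub_Iic hint (hint.mono_set (Set.Iic_subset_Iic.2 hx))]
    ring
  have hderiv : ∀ x < c, HasDerivAt (fun x => ∫ u in Set.Iic x, f u) (f x) x := by
    intro x hx
    have hcont : ContinuousOn f (Set.Iio c) := hf.mono Set.Iio_subset_Iic_self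
    have h := (intervalIntegral.integral_hasDerivAt_right (a := c)
      ((hf.mono (by rw [Set.uIcc_of_ge hx.le]; exact Set.Icc_subset_Iic_self)).intervalIntegrable)
      (hcont.stronglyMeasurableAtFilter isOpen_Iio x hx)
      (hcont.continuousAt (Iio_mem_nhds hx))).const_add (∫ u in Set.Iic c, f u)
    refine h.congr_of_eventuallyEq ?_
    filter_upwards [Iio_mem_nhds hx] with y hy
    exact (hprim y (le_of_lt hy)).symm
  have hpow : Tendsto (fun x : ℝ => (x⁻¹) ^ n) atBot (𝓝 0) := by
    have h := (tendsto_inv_atBot_zero (𝕜 := ℝ)).pow n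
    rwa [zero_pow (by omega)] at h
  have hlim := HasDerivAt.lhopital_zero_atBot (l := 𝓝 (-C / n))
    (f := fun x => ∫ u in Set.Iic x, f u) (f' := f)
    (g := fun x : ℝ => (x⁻¹) ^ n) (g' := fun x => n * (x⁻¹) ^ (n - 1) * (-(x ^ 2)⁻¹))
    (by filter_upwards [eventually_lt_atBot c] with x hx using hderiv x hx)
    (by
      filter_upwards [eventually_lt_atBot 0] with x hx
      exact (hasDerivAt_inv hx.ne).pow n)
    (by
      filter_upwards [eventually_lt_atBot 0] with x hx
      have := hx.ne
      simp [hn0, this])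
    (tendsto_integral_Iic_zero tendsto_id) hpow
    (by
      refine (hC.neg.div_const (n : ℝ)).congr' ?_
      filter_upwards [eventually_lt_atBot 0] with x hx
      have := hx.ne
      obtain ⟨m, rfl⟩ := Nat.exists_eq_add_of_le' hn
      simp only [Nat.add_sub_cancel, inv_pow]
      field_simp
      ring)
  refine hlim.congr fun x => ?_
  rw [inv_pow, div_inv_eq_mul, mul_comm]

/-- Asymptotics at `x0 = −∞` in part (II-i-1) of the proof of Theorem 4.2:
the improper-integral formula for the momentum profile (γ = 0) is well defined
and `φ(x) → −μ/((d+2)a²)` as `x → −∞`. -/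
theorem stmt15 (d : ℕ) (hd : 1 ≤ d) (a b lam nu mu : ℝ) (ha : a < 0) (hlam : lam < 0)
    (x1 : ℝ)
    (hpos1 : ∀ x ≤ x1, 0 < a * x + b)
    (hpos2 : ∀ x ≤ x1, 0 < nu + lam * x)
    (hne : ∀ x ≤ x1, a * lam * x + 2 * a * nu - b * lam ≠ 0)
    (φ : ℝ → ℝ)
    (hφ : ∀ x, φ x =
      (b + a * x) ^ (2 * d + 1) * (a * lam * x + 2 * a * nu - b * lam) / (nu + lam * x) ^ d *
        ∫ u in Set.Iic x,
          mu * (nu + lam * u) ^ (d + 1) /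
            ((b + a * u) ^ (2 * d + 2) * (a * lam * u + 2 * a * nu - b * lam) ^ 2)) :
    (∀ x ≤ x1, IntegrableOn
        (fun u => mu * (nu + lam * u) ^ (d + 1) /
          ((b + a * u) ^ (2 * d + 2) * (a * lam * u + 2 * a * nu - b * lam) ^ 2))
        (Set.Iic x)) ∧
      Filter.Tendsto φ Filter.atBot (nhds (-mu / (((d : ℝ) + 2) * a ^ 2))) := by
  set f : ℝ → ℝ := fun u => mu * (nu + lam * u) ^ (d + 1) /
    ((b + a * u) ^ (2 * d + 2) * (a * lam * u + 2 * a * nu - b * lam) ^ 2) with hf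
  have hcont : ContinuousOn f (Set.Iic x1) := by
    refine ContinuousOn.div (by fun_prop) (by fun_prop) fun x hx => ?_
    have h1 : b + a * x ≠ 0 := by linarith [hpos1 x hx]
    exact mul_ne_zero (pow_ne_zero _ h1) (pow_ne_zero _ (hne x hx))
  have hnu : Filter.Tendsto (fun x : ℝ => (nu + lam * x) / x) Filter.atBot (nhds lam) := by
    simpa only [add_comm] using tendsto_affine_div_atBot lam nu
  have hb : Filter.Tendsto (fun x : ℝ => (b + a * x) / x) Filter.atBot (nhds a) := by
    simpa only [add_comm] using tendsto_affine_div_atBot a b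
  have hq : Filter.Tendsto (fun x : ℝ => (a * lam * x + 2 * a * nu - b * lam) / x)
      Filter.atBot (nhds (a * lam)) := by
    simpa only [add_sub_assoc] using tendsto_affine_div_atBot (a * lam) (2 * a * nu - b * lam)
  have ha0 := ha.ne
  have hlam0 := hlam.ne
  have hlim : Filter.Tendsto (fun x => x ^ (d + 2 + 1) * f x) Filter.atBot
      (nhds (mu * lam ^ (d + 1) / (a ^ (2 * d + 2) * (a * lam) ^ 2))) := by
    refine (((hnu.pow (d + 1)).const_mul mu).div ((hb.pow (2 * d + 2)).mul (hq.pow 2))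
      (by positivity)).congr' ?_
    filter_upwards [Filter.eventually_lt_atBot 0, Filter.eventually_le_atBot x1] with x hx hx1
    have hx0 := hx.ne
    have h1 : b + a * x ≠ 0 := by linarith [hpos1 x hx1]
    have h2 := hne x hx1
    simp only [hf, Pi.div_apply, div_pow]
    generalize b + a * x = B at *
    generalize a * lam * x + 2 * a * nu - b * lam = Q at *
    generalize nu + lam * x = N at *
    field_simp
    ring
  refine ⟨fun x hx => (integrableOn_Iic_of_tendsto_pow_mul (by omega) hcont hlim).mono_set
    (Set.Iic_subset_Iic.2 hx), ?_⟩
  have hI := tendsto_pow_mul_integral_Iic (by omega) hcont hlim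
  have hφlim := (((hb.pow (2 * d + 1)).mul hq).div (hnu.pow d) (pow_ne_zero d hlam0)).mul hI
  have hval : a ^ (2 * d + 1) * (a * lam) / lam ^ d *
      (-(mu * lam ^ (d + 1) / (a ^ (2 * d + 2) * (a * lam) ^ 2)) / ((d + 2 : ℕ) : ℝ)) =
      -mu / (((d : ℝ) + 2) * a ^ 2) := by
    push_cast
    field_simp
    ring
  rw [hval] at hφlim
  refine hφlim.congr' ?_
  filter_upwards [Filter.eventually_lt_atBot 0, Filter.eventually_le_atBot x1] with x hx hx1
  have hx0 := hx.ne
  have h3 := (hpos2 x hx1).ne'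
  rw [hφ x]
  simp only [Pi.div_apply, div_pow]
  generalize (∫ u in Set.Iic x, f u) = I
  generalize b + a * x = B at *
  generalize a * lam * x + 2 * a * nu - b * lam = Q at *
  generalize nu + lam * x = N at *
  field_simp
  ring
end

section
/- Let d ≥ 1 be an integer and a, λ, μ real numbers with a < 0, a ≤ λ, λ ≠ 0 and μ ≤ 0. Set γ := λ+μ−2a and define for x ∈ (0, −1/a): φ(x) := ((1+ax)^(2d+1)·(aλx+2a−λ)/(1+λx)^d) · ∫₀^x (1+λu)^d·(μ(1+λu) − γ(1+au)²) / ((1+au)^(2d+2)·(aλu+2a−λ)²) du. Then φ(x) > 0 for every x ∈ (0, −1/a). -/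
/-- For `a < 0`, `a ≤ lam`, `mu ≤ 0` and `0 ≤ u` with `0 < 1 + a * u`, the factors of the
integrand of the momentum profile have constant signs. -/
lemma momentum_factor_signs {a lam mu u : ℝ} (ha : a < 0) (halam : a ≤ lam) (hmu : mu ≤ 0)
    (hu : 0 ≤ u) (ht : 0 < 1 + a * u) :
    0 < 1 + lam * u ∧ a * lam * u + 2 * a - lam < 0 ∧
      mu * (1 + lam * u) - (lam + mu - 2 * a) * (1 + a * u) ^ 2 < 0 := by
  have hau : a * u ≤ 0 := mul_nonpos_of_nonpos_of_nonneg ha.le hu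
  have hle : 1 + a * u ≤ 1 + lam * u := by gcongr
  refine ⟨ht.trans_le hle, ?_, ?_⟩
  · nlinarith [mul_nonneg (sub_nonneg.2 halam) (by linarith : 0 ≤ 1 - a * u),
      mul_neg_of_neg_of_pos ha ht]
  · have hsq : 0 ≤ 1 + lam * u - (1 + a * u) ^ 2 := by nlinarith
    have hpos : 0 < (lam - 2 * a) * (1 + a * u) ^ 2 := mul_pos (by linarith) (pow_pos ht 2)
    nlinarith [mul_nonneg_of_nonpos_of_nonpos hmu (neg_nonpos.2 hsq)]


/-- Positivity of the momentum profile on `(0, −1/a)` in Part (I) of the proof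
of Theorem 4.2 (cases (I-i) and (I-iii-2)). -/
theorem stmt16 (d : ℕ) (hd : 1 ≤ d) (a lam mu : ℝ)
    (ha : a < 0) (halam : a ≤ lam) (hlam : lam ≠ 0) (hmu : mu ≤ 0)
    (γ : ℝ) (hγ : γ = lam + mu - 2 * a)
    (φ : ℝ → ℝ)
    (hφ : ∀ x ∈ Set.Ioo 0 (-1 / a), φ x =
      (1 + a * x) ^ (2 * d + 1) * (a * lam * x + 2 * a - lam) / (1 + lam * x) ^ d *
        ∫ u in (0:ℝ)..x,
          (1 + lam * u) ^ d * (mu * (1 + lam * u) - γ * (1 + a * u) ^ 2) /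
            ((1 + a * u) ^ (2 * d + 2) * (a * lam * u + 2 * a - lam) ^ 2)) :
    ∀ x ∈ Set.Ioo 0 (-1 / a), 0 < φ x := by
  intro x hx
  have hpos : ∀ u ≤ x, 0 < 1 + a * u := by
    intro u hu
    have hxa := (lt_div_iff_of_neg ha).1 hx.2
    nlinarith
  obtain ⟨hL, hQ, -⟩ := momentum_factor_signs ha halam hmu hx.1.le (hpos x le_rfl)
  rw [hφ x hx]
  refine mul_pos_of_neg_of_neg (div_neg_of_neg_of_pos
    (mul_neg_of_pos_of_neg (pow_pos (hpos x le_rfl) _) hQ) (pow_pos hL d)) ?_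
  rw [← neg_pos, ← intervalIntegral.integral_neg]
  refine intervalIntegral.intervalIntegral_pos_of_pos_on ?_ (fun u hu => ?_) hx.1
  · refine (ContinuousOn.neg (ContinuousOn.div (by fun_prop) (by fun_prop)
      fun u hu => ?_)).intervalIntegrable
    rw [Set.uIcc_of_le hx.1.le] at hu
    have ht := hpos u hu.2
    exact mul_ne_zero (pow_pos ht _).ne'
      (pow_ne_zero 2 (momentum_factor_signs ha halam hmu hu.1 ht).2.1.ne)
  · have ht := hpos u hu.2.le
    obtain ⟨hL, hQ, hN⟩ := momentum_factor_signs ha halam hmu hu.1.le ht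
    rw [neg_pos, hγ]
    exact div_neg_of_neg_of_pos (mul_neg_of_pos_of_neg (pow_pos hL d) hN)
      (mul_pos (pow_pos ht _) (sq_pos_of_neg hQ))
end

section
/- Let d ≥ 1 be an integer and a, b, λ, ν, μ, γ real numbers, let x0 be a real number with γ·(b+ax0)² = μ·(ν+λx0), and let I be an open interval containing x0 on which ax+b > 0, ν+λx > 0 and aλx+2aν−bλ ≠ 0. Then for every x ∈ I: ((ax+b)^(2d+1)·(aλx+2aν−bλ)/(ν+λx)^d) · ∫_{x0}^x (ν+λu)^d·(μ(ν+λu) − γ(au+b)²) / ((au+b)^(2d+2)·(aλu+2aν−bλ)²) du = ((b+ax)^(2d+1)/(ν+λx)^d) · ∫_{x0}^x (x−u)·(ν+λu)^(d−1)·(dγ(au+b)² − (d+1)μ(ν+λu)) / (b+au)^(2d+3) du. -/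
/-- The difference of the two integrands has the primitive `(x - u) W(u) / L(u)`, where
`L(u) = a λ u + 2 a ν - b λ` and `W(u) = (ν + λ u)^d (μ (ν + λ u) - γ (a u + b)²) / (a u + b)^(2d+2)`,
here with `d = k + 1`. -/
theorem hasDerivAt_taylor_sub_firstOrder (k : ℕ) (a b lam nu mu γ x u : ℝ)
    (hA : a * u + b ≠ 0) (hL : a * lam * u + 2 * a * nu - b * lam ≠ 0) :
    HasDerivAt
      (fun u : ℝ => (x - u) * ((nu + lam * u) ^ (k + 1) *
        (mu * (nu + lam * u) - γ * (a * u + b) ^ 2)) /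
        ((a * u + b) ^ (2 * (k + 1) + 2) * (a * lam * u + 2 * a * nu - b * lam)))
      ((x - u) * (nu + lam * u) ^ k *
          (((k + 1 : ℕ) : ℝ) * γ * (a * u + b) ^ 2 -
            (((k + 1 : ℕ) : ℝ) + 1) * mu * (nu + lam * u)) /
          (b + a * u) ^ (2 * (k + 1) + 3) -
        (a * lam * x + 2 * a * nu - b * lam) *
          ((nu + lam * u) ^ (k + 1) * (mu * (nu + lam * u) - γ * (a * u + b) ^ 2) /
            ((a * u + b) ^ (2 * (k + 1) + 2) *
              (a * lam * u + 2 * a * nu - b * lam) ^ 2))) u := by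
  have hid := hasDerivAt_id' u
  have dA : HasDerivAt (fun u : ℝ => a * u + b) a u := by
    simpa using (hid.const_mul a).add_const b
  have dN : HasDerivAt (fun u : ℝ => nu + lam * u) lam u := by
    simpa using (hid.const_mul lam).const_add nu
  have dL : HasDerivAt (fun u : ℝ => a * lam * u + 2 * a * nu - b * lam) (a * lam) u := by
    simpa using ((hid.const_mul (a * lam)).add_const (2 * a * nu)).sub_const (b * lam)
  have h := ((hid.const_sub x).mul ((dN.pow (k + 1)).mul
    ((dN.const_mul mu).sub ((dA.pow 2).const_mul γ)))).div
    ((dA.pow (2 * (k + 1) + 2)).mul dL) (mul_ne_zero (pow_ne_zero _ hA) hL)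
  refine h.congr_deriv ?_
  simp only [Pi.mul_apply, Pi.sub_apply, Pi.pow_apply, Nat.add_sub_cancel]
  rw [add_comm b (a * u)]
  push_cast
  have hP : (a * u + b) ^ (2 * k) ≠ 0 := pow_ne_zero _ hA
  have hLx : a * lam * x + 2 * a * nu - b * lam =
      a * lam * u + 2 * a * nu - b * lam + a * lam * (x - u) := by ring
  have hLAN : a * lam * u + 2 * a * nu - b * lam =
      2 * a * (nu + lam * u) - lam * (a * u + b) := by ring
  rw [hLx, show 2 * (k + 1) + 1 = 2 * k + 3 by omega,
    show 2 * (k + 1) + 2 = 2 * k + 4 by omega, show 2 * (k + 1) + 3 = 2 * k + 5 by omega]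
  simp only [pow_add _ (2 * k), pow_succ _ k]
  generalize (a * u + b) ^ (2 * k) = P at hP ⊢
  generalize (nu + lam * u) ^ k = Q
  generalize a * lam * u + 2 * a * nu - b * lam = L at hL hLAN ⊢
  generalize a * u + b = A at hA hLAN ⊢
  generalize nu + lam * u = N at hLAN ⊢
  generalize x - u = y
  field_simp
  rw [hLAN]
  ring

/-- Second-order integral representation used in the proof of Theorem 4.2:
when `γ(b+ax0)² = μ(ν+λx0)`, the first-order integral formula for the momentum
profile coincides with the Taylor-remainder representation. -/
theorem stmt17 (d : ℕ) (hd : 1 ≤ d) (a b lam nu mu γ x0 : ℝ)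
    (hγ : γ * (b + a * x0) ^ 2 = mu * (nu + lam * x0))
    (p q : ℝ) (hp : p < x0) (hq : x0 < q)
    (hpos1 : ∀ x ∈ Set.Ioo p q, 0 < a * x + b)
    (hpos2 : ∀ x ∈ Set.Ioo p q, 0 < nu + lam * x)
    (hne : ∀ x ∈ Set.Ioo p q, a * lam * x + 2 * a * nu - b * lam ≠ 0) :
    ∀ x ∈ Set.Ioo p q,
      (a * x + b) ^ (2 * d + 1) * (a * lam * x + 2 * a * nu - b * lam) / (nu + lam * x) ^ d *
          ∫ u in x0..x,
            (nu + lam * u) ^ d * (mu * (nu + lam * u) - γ * (a * u + b) ^ 2) /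
              ((a * u + b) ^ (2 * d + 2) * (a * lam * u + 2 * a * nu - b * lam) ^ 2) =
        (b + a * x) ^ (2 * d + 1) / (nu + lam * x) ^ d *
          ∫ u in x0..x,
            (x - u) * (nu + lam * u) ^ (d - 1) *
              ((d : ℝ) * γ * (a * u + b) ^ 2 - ((d : ℝ) + 1) * mu * (nu + lam * u)) /
              (b + a * u) ^ (2 * d + 3) := by
  intro x hx
  obtain ⟨k, rfl⟩ : ∃ k, d = k + 1 := ⟨d - 1, by omega⟩
  have hsub : Set.uIcc x0 x ⊆ Set.Ioo p q := Set.ordConnected_Ioo.uIcc_subset ⟨hp, hq⟩ hx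
  have hA : ∀ u ∈ Set.uIcc x0 x, a * u + b ≠ 0 := fun u hu => (hpos1 u (hsub hu)).ne'
  have hA' : ∀ u ∈ Set.uIcc x0 x, b + a * u ≠ 0 := fun u hu => by
    rw [add_comm]; exact hA u hu
  have hL : ∀ u ∈ Set.uIcc x0 x, a * lam * u + 2 * a * nu - b * lam ≠ 0 :=
    fun u hu => hne u (hsub hu)
  have hf : IntervalIntegrable (fun u => (nu + lam * u) ^ (k + 1) *
      (mu * (nu + lam * u) - γ * (a * u + b) ^ 2) /
      ((a * u + b) ^ (2 * (k + 1) + 2) * (a * lam * u + 2 * a * nu - b * lam) ^ 2))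
      MeasureTheory.volume x0 x :=
    (ContinuousOn.div (by fun_prop) (by fun_prop) fun u hu =>
      mul_ne_zero (pow_ne_zero _ (hA u hu)) (pow_ne_zero _ (hL u hu))).intervalIntegrable
  have hg : IntervalIntegrable (fun u => (x - u) * (nu + lam * u) ^ k *
      (((k + 1 : ℕ) : ℝ) * γ * (a * u + b) ^ 2 -
        (((k + 1 : ℕ) : ℝ) + 1) * mu * (nu + lam * u)) /
      (b + a * u) ^ (2 * (k + 1) + 3)) MeasureTheory.volume x0 x :=
    (ContinuousOn.div (by fun_prop) (by fun_prop) fun u hu =>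
      pow_ne_zero _ (hA' u hu)).intervalIntegrable
  have hFTC := intervalIntegral.integral_eq_sub_of_hasDerivAt
    (fun u hu => hasDerivAt_taylor_sub_firstOrder k a b lam nu mu γ x u (hA u hu) (hL u hu))
    (hg.sub (hf.const_mul _))
  have hW : mu * (nu + lam * x0) - γ * (a * x0 + b) ^ 2 = 0 := by
    rw [add_comm (a * x0), hγ, sub_self]
  rw [intervalIntegral.integral_sub hg (hf.const_mul _),
    intervalIntegral.integral_const_mul, hW] at hFTC
  simp only [sub_self, zero_mul, mul_zero, zero_div] at hFTC
  rw [Nat.add_sub_cancel, sub_eq_zero.mp hFTC, add_comm b (a * x)]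
  ring
end

section
/- Let d ≥ 1 be an integer and a, b, λ, ν, γ real numbers with a > 0. Set c := −b/a and assume ν+λc > 0. Let x1 > c be a real number such that for all x ∈ (c, x1]: ν+λx > 0 and aλx+2aν−bλ ≠ 0. Define for x ∈ (c, x1): φ(x) := −γ·((aλx+2aν−bλ)·(ax+b)^(2d+1)/(ν+λx)^d) · ∫_{x1}^x (ν+λu)^d / ((au+b)^(2d)·(aλu+2aν−bλ)²) du. Then φ(x)/(ax+b)² tends to γ/(2(2d−1)·a·(aν−bλ)) as x tends to c from the right. -/
open Topology

/-- If `F' ≥ K (x - c)^{-(n+1)}` to the right of `c`, then `(x - c)^n F x` is eventually below any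
number larger than `-K / n`. -/
theorem eventually_pow_mul_lt_of_le_deriv {F f : ℝ → ℝ} {c K r : ℝ} {n : ℕ} (hn : n ≠ 0)
    (hF : ∀ᶠ x in 𝓝[>] c, HasDerivAt F (f x) x)
    (hf : ∀ᶠ x in 𝓝[>] c, K ≤ f x * (x - c) ^ (n + 1)) (hr : -K / n < r) :
    ∀ᶠ x in 𝓝[>] c, (x - c) ^ n * F x < r := by
  obtain ⟨e, hce, he⟩ := mem_nhdsGT_iff_exists_Ioo_subset.1 (hF.and hf)
  have hce' : c < e := hce
  have hn' : (n : ℝ) ≠ 0 := Nat.cast_ne_zero.2 hn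
  have hd : ∀ x ∈ Set.Ioo c e, HasDerivAt (fun x => F x + K / n * ((x - c) ^ n)⁻¹)
      (f x - K / (x - c) ^ (n + 1)) x := by
    intro x hx
    have hxc : x - c ≠ 0 := (sub_pos.2 hx.1).ne'
    have h1 := ((((hasDerivAt_id x).sub_const c).pow n).inv (pow_ne_zero n hxc)).const_mul (K / n)
    refine ((he hx).1.add h1).congr_deriv ?_
    obtain ⟨m, rfl⟩ := Nat.exists_eq_succ_of_ne_zero hn
    simp only [id, Nat.succ_eq_add_one, Nat.add_sub_cancel, Pi.pow_apply] at hn' ⊢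
    field_simp
    ring
  have hmono : MonotoneOn (fun x => F x + K / n * ((x - c) ^ n)⁻¹) (Set.Ioo c e) := by
    refine monotoneOn_of_deriv_nonneg (convex_Ioo c e)
      (fun x hx => (hd x hx).continuousAt.continuousWithinAt)
      (fun x hx => (hd x (interior_subset hx)).differentiableAt.differentiableWithinAt) ?_
    intro x hx
    have hx := interior_subset hx
    have hxc : 0 < x - c := sub_pos.2 hx.1
    rw [(hd x hx).deriv, sub_nonneg, div_le_iff₀ (by positivity)]
    exact (he hx).2
  obtain ⟨p, hp⟩ := exists_between hce'
  set G := F p + K / n * ((p - c) ^ n)⁻¹ with hG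
  have hlim : Filter.Tendsto (fun x => -K / n + (x - c) ^ n * G) (𝓝[>] c) (𝓝 (-K / n)) := by
    have : ContinuousAt (fun x => -K / n + (x - c) ^ n * G) c := by fun_prop
    have h := this.tendsto
    simp only [sub_self, zero_pow hn, zero_mul, add_zero] at h
    exact h.mono_left nhdsWithin_le_nhds
  filter_upwards [hlim.eventually_lt_const hr, Ioo_mem_nhdsGT hp.1] with x hx hxp
  have hxc : 0 < (x - c) ^ n := pow_pos (sub_pos.2 hxp.1) n
  have h := mul_le_mul_of_nonneg_left
    (hmono ⟨hxp.1, hxp.2.trans hp.2⟩ hp hxp.2.le) hxc.le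
  have h2 : (x - c) ^ n * (K / n * ((x - c) ^ n)⁻¹) = K / n := by field_simp
  simp only [← hG, mul_add, h2] at h
  rw [neg_div] at hx
  linarith

/-- A form of l'Hôpital's rule at a pole: if `F' x * (x - c)^(n+1) → L` as `x → c⁺`, then
`(x - c)^n * F x → -L / n`. -/
theorem tendsto_pow_mul_of_deriv {F f : ℝ → ℝ} {c L : ℝ} {n : ℕ} (hn : n ≠ 0)
    (hF : ∀ᶠ x in 𝓝[>] c, HasDerivAt F (f x) x)
    (hf : Filter.Tendsto (fun x => f x * (x - c) ^ (n + 1)) (𝓝[>] c) (𝓝 L)) :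
    Filter.Tendsto (fun x => (x - c) ^ n * F x) (𝓝[>] c) (𝓝 (-L / n)) := by
  have hn' : (0 : ℝ) < n := Nat.cast_pos.2 (Nat.pos_of_ne_zero hn)
  refine tendsto_order.2 ⟨fun r hr => ?_, fun r hr => ?_⟩
  · rw [lt_div_iff₀ hn'] at hr
    obtain ⟨K, hK⟩ := exists_between hr
    have h := eventually_pow_mul_lt_of_le_deriv (F := fun x => -F x) (f := fun x => -f x)
      (K := K) (r := -r) hn (hF.mono fun x hx => hx.neg)
      ((hf.eventually_lt_const (lt_neg_of_lt_neg hK.2)).mono fun x hx => by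
        linarith) (by rw [div_lt_iff₀ hn']; linarith [hK.1])
    exact h.mono fun x hx => by linarith
  · rw [gt_iff_lt, div_lt_iff₀ hn'] at hr
    obtain ⟨K, hK⟩ := exists_between hr
    exact eventually_pow_mul_lt_of_le_deriv (K := -K) hn hF
      ((hf.eventually_const_lt (neg_lt_of_neg_lt hK.1)).mono fun x hx => hx.le)
      (by rw [div_lt_iff₀ hn']; linarith [hK.2])

/-- Endpoint limit in part (III-ii-1) of the proof of Theorem 4.2 (μ = 0):
`φ(x)/(ax+b)² → γ/(2(2d−1)a(aν−bλ))` as `x → c⁺`, where `c = −b/a`. -/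
theorem stmt19 (d : ℕ) (hd : 1 ≤ d) (a b lam nu γ : ℝ) (ha : 0 < a)
    (c : ℝ) (hc : c = -b / a) (hnlc : 0 < nu + lam * c)
    (x1 : ℝ) (hx1 : c < x1)
    (hpos : ∀ x ∈ Set.Ioc c x1, 0 < nu + lam * x)
    (hne : ∀ x ∈ Set.Ioc c x1, a * lam * x + 2 * a * nu - b * lam ≠ 0)
    (φ : ℝ → ℝ)
    (hφ : ∀ x ∈ Set.Ioo c x1, φ x =
      -γ * ((a * lam * x + 2 * a * nu - b * lam) * (a * x + b) ^ (2 * d + 1) /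
          (nu + lam * x) ^ d) *
        ∫ u in x1..x,
          (nu + lam * u) ^ d /
            ((a * u + b) ^ (2 * d) * (a * lam * u + 2 * a * nu - b * lam) ^ 2)) :
    Filter.Tendsto (fun x => φ x / (a * x + b) ^ 2) (𝓝[>] c)
      (𝓝 (γ / (2 * (2 * (d : ℝ) - 1) * a * (a * nu - b * lam)))) := by
  obtain ⟨m, rfl⟩ := Nat.exists_eq_add_of_le' hd
  obtain rfl : b = -(a * c) := by rw [hc]; field_simp
  set g : ℝ → ℝ := fun u => (nu + lam * u) ^ (m + 1) /
    ((a * u + -(a * c)) ^ (2 * (m + 1)) * (a * lam * u + 2 * a * nu - -(a * c) * lam) ^ 2) with hg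
  have hgc : ContinuousOn g (Set.Ioc c x1) := by
    refine ContinuousOn.div (by fun_prop) (by fun_prop) fun u hu => ?_
    have h1 : a * u + -(a * c) ≠ 0 := by
      have := mul_pos ha (sub_pos.2 hu.1)
      linarith
    exact mul_ne_zero (pow_ne_zero _ h1) (pow_ne_zero _ (hne u hu))
  have hderiv : ∀ᶠ x in 𝓝[>] c, HasDerivAt (fun x => ∫ u in x1..x, g u) (g x) x := by
    filter_upwards [Ioo_mem_nhdsGT hx1] with x hx
    have hgo := hgc.mono Set.Ioo_subset_Ioc_self
    refine intervalIntegral.integral_hasDerivAt_right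
      (ContinuousOn.intervalIntegrable (hgc.mono ?_))
      (hgo.stronglyMeasurableAtFilter isOpen_Ioo x hx) (hgo.continuousAt (isOpen_Ioo.mem_nhds hx))
    rw [Set.uIcc_of_ge hx.2.le]
    exact fun u hu => ⟨hx.1.trans_le hu.1, hu.2⟩
  have hQ : a * lam * c + 2 * a * nu - -(a * c) * lam = 2 * a * (nu + lam * c) := by ring
  have hQ0 : a * lam * c + 2 * a * nu - -(a * c) * lam ≠ 0 := by rw [hQ]; positivity
  have hlimg : Filter.Tendsto (fun x => g x * (x - c) ^ (2 * m + 1 + 1)) (𝓝[>] c)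
      (𝓝 ((nu + lam * c) ^ (m + 1) /
        (a ^ (2 * (m + 1)) * (a * lam * c + 2 * a * nu - -(a * c) * lam) ^ 2))) := by
    have h : ContinuousAt (fun x => (nu + lam * x) ^ (m + 1) /
        (a ^ (2 * (m + 1)) * (a * lam * x + 2 * a * nu - -(a * c) * lam) ^ 2)) c :=
      ContinuousAt.div (by fun_prop) (by fun_prop) (by positivity)
    refine (h.tendsto.mono_left nhdsWithin_le_nhds).congr' ?_
    filter_upwards [Ioo_mem_nhdsGT hx1] with x hx
    have hxc : x - c ≠ 0 := (sub_pos.2 hx.1).ne'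
    have hq := hne x ⟨hx.1, hx.2.le⟩
    rw [hg]
    dsimp only
    rw [show a * x + -(a * c) = a * (x - c) by ring, mul_pow,
      show 2 * m + 1 + 1 = 2 * (m + 1) by ring]
    field_simp
  have hpre : ContinuousAt (fun x => -γ * ((a * lam * x + 2 * a * nu - -(a * c) * lam) *
      a ^ (2 * m + 1) / (nu + lam * x) ^ (m + 1))) c :=
    continuousAt_const.mul (ContinuousAt.div (by fun_prop) (by fun_prop) (by positivity))
  have key := (hpre.tendsto.mono_left nhdsWithin_le_nhds).mul
    (tendsto_pow_mul_of_deriv (Nat.succ_ne_zero (2 * m)) hderiv hlimg)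
  have hval : γ / (2 * (2 * ((m + 1 : ℕ) : ℝ) - 1) * a * (a * nu - -(a * c) * lam)) =
      -γ * ((a * lam * c + 2 * a * nu - -(a * c) * lam) *
        a ^ (2 * m + 1) / (nu + lam * c) ^ (m + 1)) *
      (-((nu + lam * c) ^ (m + 1) /
        (a ^ (2 * (m + 1)) * (a * lam * c + 2 * a * nu - -(a * c) * lam) ^ 2)) /
        ((2 * m).succ : ℕ)) := by
    have h2 : a * nu - -(a * c) * lam = a * (nu + lam * c) := by ring
    have h3 : 2 * ((m : ℝ) + 1) - 1 = 2 * m + 1 := by ring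
    have h4 : (2 * (m : ℝ) + 1) ≠ 0 := by positivity
    rw [hQ, h2]
    push_cast
    rw [h3]
    generalize nu + lam * c = N at hnlc
    field_simp
    ring
  rw [hval]
  refine key.congr' ?_
  filter_upwards [Ioo_mem_nhdsGT hx1] with x hx
  have hxc : x - c ≠ 0 := (sub_pos.2 hx.1).ne'
  have hp := (hpos x ⟨hx.1, hx.2.le⟩).ne'
  rw [hφ x hx, show a * x + -(a * c) = a * (x - c) by ring]
  generalize (∫ u in x1..x, g u) = I
  generalize a * lam * x + 2 * a * nu - -(a * c) * lam = q
  rw [Nat.succ_eq_add_one, mul_pow, mul_pow]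
  generalize x - c = t at hxc
  field_simp
  ring
end
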